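/- For every integer n ≥ 3 and every α ∈ (0,π): every plane α-bend graph on a set of n points in ℝ² has at most 3n−6 edges, and there exists a set of n points carrying a plane α-bend graph with exactly 3n−6 edges. Moreover, for every α ∈ [π/2,π): every plane α-arc graph on a set of n points has at most 3n−6 edges, and there exists a set of n points carrying a plane α-arc graph with exactly 3n−6 edges. -/

import Mathlib

open EuclideanGeometry Real Set

noncomputable section

/-- The Euclidean plane. -/
abbrev Pt : Type := EuclideanSpace ℝ (Fin 2)

/-- The image of a one-bend edge `(a,b,c)`: the union of segments `[a,b]` and `[b,c]`. -/
def bendImage (e : Pt × Pt × Pt) : Set Pt :=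
  segment ℝ e.1 e.2.1 ∪ segment ℝ e.2.1 e.2.2

/-- The endpoints of a (bend or arc) edge `(a,b,c)` are `a` and `c`. -/
def edgeEndpoints (e : Pt × Pt × Pt) : Set Pt := {e.1, e.2.2}

/-- An `α`-bend edge: a triple `(a,b,c)` with `a ≠ c` and angle `α` at `b`. -/
def IsBendEdge (α : ℝ) (e : Pt × Pt × Pt) : Prop :=
  e.1 ≠ e.2.2 ∧ ∠ e.1 e.2.1 e.2.2 = α

/-- A plane `α`-bend multigraph on a finite vertex set `V`. -/
def IsPlaneBendMultigraph (α : ℝ) (V : Finset Pt) (E : Finset (Pt × Pt × Pt)) : Prop :=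
  (∀ e ∈ E, IsBendEdge α e ∧ e.1 ∈ V ∧ e.2.2 ∈ V) ∧
  (∀ e ∈ E, ∀ f ∈ E, e ≠ f → bendImage e ≠ bendImage f) ∧
  (∀ e ∈ E, ∀ v ∈ V, (v : Pt) ∈ bendImage e → (v : Pt) ∈ edgeEndpoints e) ∧
  (∀ e ∈ E, ∀ f ∈ E, e ≠ f →
    bendImage e ∩ bendImage f ⊆ edgeEndpoints e ∩ edgeEndpoints f)

/-- A plane `α`-bend graph: a plane `α`-bend multigraph in which distinct edges
have distinct endpoint pairs. -/
def IsPlaneBendGraph (α : ℝ) (V : Finset Pt) (E : Finset (Pt × Pt × Pt)) : Prop :=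
  IsPlaneBendMultigraph α V E ∧
  ∀ e ∈ E, ∀ f ∈ E, e ≠ f → edgeEndpoints e ≠ edgeEndpoints f

/-- An `α`-arc edge: a triple `(a,b,c)` with `a ≠ c`, `b` off of the line `ac`,
and angle `α` at `b`. -/
def IsArcEdge (α : ℝ) (e : Pt × Pt × Pt) : Prop :=
  e.1 ≠ e.2.2 ∧ e.2.1 ∉ affineSpan ℝ ({e.1, e.2.2} : Set Pt) ∧ ∠ e.1 e.2.1 e.2.2 = α

/-- The image of an arc edge `(a,b,c)`: `{a,c}` together with the points strictly on the
same side of line `ac` as `b` from which the segment `ac` subtends the same angle as at `b`. -/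
def arcImage (e : Pt × Pt × Pt) : Set Pt :=
  ({e.1, e.2.2} : Set Pt) ∪
    {x : Pt | (affineSpan ℝ ({e.1, e.2.2} : Set Pt)).SSameSide x e.2.1 ∧
      ∠ e.1 x e.2.2 = ∠ e.1 e.2.1 e.2.2}

/-- A plane `α`-arc multigraph on a finite vertex set `V`. -/
def IsPlaneArcMultigraph (α : ℝ) (V : Finset Pt) (E : Finset (Pt × Pt × Pt)) : Prop :=
  (∀ e ∈ E, IsArcEdge α e ∧ e.1 ∈ V ∧ e.2.2 ∈ V) ∧
  (∀ e ∈ E, ∀ f ∈ E, e ≠ f → arcImage e ≠ arcImage f) ∧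
  (∀ e ∈ E, ∀ v ∈ V, (v : Pt) ∈ arcImage e → (v : Pt) ∈ edgeEndpoints e) ∧
  (∀ e ∈ E, ∀ f ∈ E, e ≠ f →
    arcImage e ∩ arcImage f ⊆ edgeEndpoints e ∩ edgeEndpoints f)

/-- A plane `α`-arc graph: a plane `α`-arc multigraph in which distinct edges
have distinct endpoint pairs. -/
def IsPlaneArcGraph (α : ℝ) (V : Finset Pt) (E : Finset (Pt × Pt × Pt)) : Prop :=
  IsPlaneArcMultigraph α V E ∧
  ∀ e ∈ E, ∀ f ∈ E, e ≠ f → edgeEndpoints e ≠ edgeEndpoints f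

/-- A finite point set is in general position if no three of its points are collinear. -/
def GenPos (P : Finset Pt) : Prop :=
  ∀ p ∈ P, ∀ q ∈ P, ∀ r ∈ P, p ≠ q → p ≠ r → q ≠ r →
    ¬ Collinear ℝ ({p, q, r} : Set Pt)

/-- A planar straight-line graph on `P`: edges are (ordered representatives of unordered)
pairs of distinct points of `P` whose closed segments pairwise intersect only in shared
endpoints, and no segment contains a point of `P` other than its endpoints. -/
def IsPSLG (P : Finset Pt) (E : Finset (Pt × Pt)) : Prop :=
  (∀ e ∈ E, e.1 ∈ P ∧ e.2 ∈ P ∧ e.1 ≠ e.2) ∧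
  (∀ e ∈ E, ∀ f ∈ E, e ≠ f → segment ℝ e.1 e.2 ≠ segment ℝ f.1 f.2) ∧
  (∀ e ∈ E, ∀ p ∈ P, (p : Pt) ∈ segment ℝ e.1 e.2 → p = e.1 ∨ p = e.2) ∧
  (∀ e ∈ E, ∀ f ∈ E, e ≠ f →
    segment ℝ e.1 e.2 ∩ segment ℝ f.1 f.2 ⊆ ({e.1, e.2} : Set Pt) ∩ ({f.1, f.2} : Set Pt))

/-- `M P`: the maximum number of edges of a planar straight-line graph on `P`. -/
def M (P : Finset Pt) : ℕ :=
  sSup {m : ℕ | ∃ E : Finset (Pt × Pt), IsPSLG P E ∧ E.card = m}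

/-- Two segments (given by their endpoint pairs) cross: they meet in exactly one point,
which lies in the relative interior (open segment) of both. -/
def SegCross (s t : Pt × Pt) : Prop :=
  ∃ x : Pt, segment ℝ s.1 s.2 ∩ segment ℝ t.1 t.2 = {x} ∧
    x ∈ openSegment ℝ s.1 s.2 ∧ x ∈ openSegment ℝ t.1 t.2

set_option linter.unusedSectionVars false
set_option linter.unusedFintypeInType false
set_option linter.unusedVariables false

section
namespace Pln
open Complex Filter Topology

/-- the polynomial whose argument is the (shifted) angle function of a piece -/
def nn (a c u z : ℂ) : ℂ := u * (c - z) * (starRingEnd ℂ) (a - z)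

lemma nn_cont (a c u : ℂ) : Continuous (nn a c u) := by
  unfold nn; fun_prop

lemma nn_ratio {a c u z0 : ℂ} (ha : z0 ≠ a) (hc : z0 ≠ c) (hu : u ≠ 0) :
    ∀ᶠ z in 𝓝 z0, arg (nn a c u z / nn a c u z0) =
      arg ((c - z) / (c - z0)) - arg ((a - z) / (a - z0)) := by
  have key : ∀ w : ℂ, z0 ≠ w → ∀ᶠ z in 𝓝 z0, |arg ((w - z) / (w - z0))| < π / 2 := by
    intro w hw
    have h0 : w - z0 ≠ 0 := sub_ne_zero.2 hw.symm
    have h1 : ContinuousAt (fun z => |arg ((w - z) / (w - z0))|) z0 := by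
      refine ContinuousAt.abs ?_
      refine ContinuousAt.comp (g := arg) (f := fun z => (w - z) / (w - z0)) ?_ (by fun_prop)
      apply continuousAt_arg
      simp [h0]
    have := h1.eventually_lt (continuousAt_const (y := π / 2)) (by simp [h0]; positivity)
    exact this
  have hne : ∀ w : ℂ, z0 ≠ w → ∀ᶠ z in 𝓝 z0, z ≠ w := fun w hw => by
    exact isOpen_ne.mem_nhds hw
  filter_upwards [key a ha, key c hc, hne a ha, hne c hc] with z h1 h2 h3 h4
  have ha' : a - z0 ≠ 0 := sub_ne_zero.2 ha.symm
  have hc' : c - z0 ≠ 0 := sub_ne_zero.2 hc.symm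
  have ha2 : a - z ≠ 0 := sub_ne_zero.2 h3.symm
  have hc2 : c - z ≠ 0 := sub_ne_zero.2 h4.symm
  have e : nn a c u z / nn a c u z0 =
      ((c - z) / (c - z0)) * (starRingEnd ℂ) ((a - z) / (a - z0)) := by
    unfold nn
    rw [map_div₀]
    have : (starRingEnd ℂ) (a - z0) ≠ 0 := (map_ne_zero _).2 ha'
    field_simp
  rw [abs_lt] at h1 h2
  have e2 : arg ((starRingEnd ℂ) ((a - z) / (a - z0))) = - arg ((a - z) / (a - z0)) := by
    rw [arg_conj, if_neg]
    linarith [pi_pos]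
  rw [e, (arg_mul_eq_add_arg_iff (div_ne_zero hc2 hc') ((map_ne_zero _).2 (div_ne_zero ha2 ha'))).2]
  · rw [e2]; ring
  · rw [e2]; constructor <;> linarith

open scoped Classical in
lemma arg_near {n0 : ℂ} (h0 : n0 ≠ 0) :
    ∀ᶠ w in 𝓝 n0, arg w = arg n0 + arg (w / n0)
      - (if n0 ∉ slitPlane ∧ w.im < 0 then 2 * π else 0) := by
  by_cases hs : n0 ∈ slitPlane
  · have h1 : ContinuousAt (fun w => arg n0 + arg (w / n0)) n0 := by
      refine ContinuousAt.add continuousAt_const ?_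
      refine ContinuousAt.comp (g := arg) (f := fun z => z / n0) ?_ (by fun_prop)
      apply continuousAt_arg
      simp [h0]
    have e1 : arg n0 + arg (n0 / n0) = arg n0 := by simp [h0]
    have hlt : arg n0 < π := lt_of_le_of_ne (arg_le_pi _) (mem_slitPlane_iff_arg.1 hs).1
    have h2 := h1.eventually_lt (continuousAt_const (y := π)) (by rw [e1]; exact hlt)
    have h3 := (continuousAt_const (y := -π)).eventually_lt h1 (by rw [e1]; exact neg_pi_lt_arg _)
    filter_upwards [h2, h3, isOpen_ne.mem_nhds h0] with w h4 h5 h6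
    have h6 : w ≠ 0 := h6
    rw [if_neg (by tauto), sub_zero, ← (arg_mul_eq_add_arg_iff h0 (div_ne_zero h6 h0)).2 ⟨h5, h4.le⟩]
    congr 1; field_simp
  · have hs' := hs
    rw [mem_slitPlane_iff] at hs
    push Not at hs
    obtain ⟨hre, him⟩ := hs
    have hre : n0.re < 0 := lt_of_le_of_ne hre fun h => h0 (Complex.ext h him)
    have hnr : n0 = ((n0.re : ℝ) : ℂ) := Complex.ext (by simp) (by simp [him])
    have hev : ∀ᶠ w : ℂ in 𝓝 n0, w.re < 0 :=
      (continuous_re.continuousAt (x := n0)).eventually_lt continuousAt_const hre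
    filter_upwards [hev] with w hw
    have e1 : arg n0 = π := arg_eq_pi_iff.2 ⟨hre, him⟩
    have e2 : arg (w / n0) = arg (-w) := by
      have : w / n0 = ((- n0.re)⁻¹ : ℝ) * (-w) := by
        conv_lhs => rw [hnr]
        have : (n0.re : ℂ) ≠ 0 := by exact_mod_cast hre.ne
        push_cast; field_simp
      rw [this, arg_real_mul]
      rw [inv_pos]; linarith
    rw [e1, e2]
    rcases lt_trichotomy w.im 0 with h | h | h
    · rw [if_pos ⟨hs', h⟩, arg_neg_eq_arg_add_pi_of_im_neg h]; ring
    · rw [if_neg (by rintro ⟨_, h'⟩; linarith)]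
      rw [arg_eq_pi_iff.2 ⟨hw, h⟩, arg_eq_zero_iff.2 ⟨by simp; linarith, by simp [h]⟩]; ring
    · rw [if_neg (by rintro ⟨_, h'⟩; linarith), arg_neg_eq_arg_sub_pi_of_im_pos h]; ring

end Pln
end

section
namespace Pln
open Complex Filter Topology

/-- A plane drawing by circular arcs / segments. -/
structure Drw (ι : Type) where
  V : Finset ℂ
  a : ι → ℂ
  c : ι → ℂ
  u : ι → ℂ
  ha : ∀ i, a i ∈ V
  hc : ∀ i, c i ∈ V
  hac : ∀ i, a i ≠ c i
  hu : ∀ i, ‖u i‖ = 1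
  hu1 : ∀ i, u i ≠ -1
  hV : ∀ i, ∀ v ∈ V, nn (a i) (c i) (u i) v ∉ slitPlane → v = a i ∨ v = c i
  hX : ∀ i j, i ≠ j → ∀ z, nn (a i) (c i) (u i) z ∉ slitPlane →
    nn (a j) (c j) (u j) z ∉ slitPlane → z ∈ V

namespace Drw
variable {ι : Type} [Fintype ι] (G : Drw ι)

/-- the angle polynomial of piece `i` -/
def n (i : ι) (z : ℂ) : ℂ := nn (G.a i) (G.c i) (G.u i) z

/-- the flow (conservation) condition -/
def Flow (f : ι → ℝ) : Prop :=
  ∀ v : ℂ, ∑ i, f i * ((if G.c i = v then 1 else 0) - (if G.a i = v then 1 else 0)) = 0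

/-- total angle -/
def F (f : ι → ℝ) (z : ℂ) : ℝ := ∑ i, f i * arg (G.n i z)

lemma n_ne_zero {i : ι} {z : ℂ} (hz : z ∉ G.V) : G.n i z ≠ 0 := by
  have h1 : z ≠ G.a i := fun h => hz (h ▸ G.ha i)
  have h2 : z ≠ G.c i := fun h => hz (h ▸ G.hc i)
  have h3 : G.u i ≠ 0 := by
    intro h; have := G.hu i; simp [h] at this
  unfold n nn
  refine mul_ne_zero (mul_ne_zero h3 (sub_ne_zero.2 h2.symm)) ((map_ne_zero _).2 (sub_ne_zero.2 h1.symm))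

lemma flow_sum {f : ι → ℝ} (hf : G.Flow f) (A : ℂ → ℝ) :
    ∑ i, f i * (A (G.c i) - A (G.a i)) = 0 := by
  have : ∀ i, f i * (A (G.c i) - A (G.a i)) =
      ∑ v ∈ G.V, A v * (f i * ((if G.c i = v then 1 else 0) - (if G.a i = v then 1 else 0))) := by
    intro i
    have e1 : A (G.c i) = ∑ v ∈ G.V, A v * (if G.c i = v then 1 else 0) := by
      simp [G.hc i]
    have e2 : A (G.a i) = ∑ v ∈ G.V, A v * (if G.a i = v then 1 else 0) := by
      simp [G.ha i]
    rw [e1, e2, ← Finset.sum_sub_distrib, Finset.mul_sum]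
    refine Finset.sum_congr rfl fun v _ => by ring
  simp_rw [this]
  rw [Finset.sum_comm]
  refine Finset.sum_eq_zero fun v _ => ?_
  rw [← Finset.mul_sum, hf v, mul_zero]

open scoped Classical in
lemma F_near {f : ι → ℝ} (hf : G.Flow f) {z0 : ℂ} (hz : z0 ∉ G.V) :
    ∀ᶠ z in 𝓝 z0, G.F f z = G.F f z0 -
      ∑ i, f i * (if G.n i z0 ∉ slitPlane ∧ (G.n i z).im < 0 then 2 * π else 0) := by
  have h1 : ∀ᶠ z in 𝓝 z0, ∀ i, arg (G.n i z / G.n i z0) =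
      arg ((G.c i - z) / (G.c i - z0)) - arg ((G.a i - z) / (G.a i - z0)) := by
    rw [eventually_all]
    intro i
    refine nn_ratio (fun h => hz (h ▸ G.ha i)) (fun h => hz (h ▸ G.hc i)) ?_
    intro h; have := G.hu i; simp [h] at this
  have h2 : ∀ᶠ z in 𝓝 z0, ∀ i, arg (G.n i z) = arg (G.n i z0) + arg (G.n i z / G.n i z0)
      - (if G.n i z0 ∉ slitPlane ∧ (G.n i z).im < 0 then 2 * π else 0) := by
    rw [eventually_all]
    intro i
    exact (nn_cont (G.a i) (G.c i) (G.u i)).continuousAt.eventually (arg_near (G.n_ne_zero hz))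
  filter_upwards [h1, h2] with z h3 h4
  have h5 := G.flow_sum hf (fun v => arg ((v - z) / (v - z0)))
  unfold F
  have h6 : ∑ i, f i * (G.n i z0).arg = ∑ i, f i * (G.n i z0).arg +
      ∑ i, f i * (((G.c i - z) / (G.c i - z0)).arg - ((G.a i - z) / (G.a i - z0)).arg) := by
    rw [h5, add_zero]
  rw [h6, ← Finset.sum_add_distrib, ← Finset.sum_sub_distrib]
  refine Finset.sum_congr rfl fun i _ => ?_
  rw [h4 i, h3 i]; ring

lemma F_near_off {f : ι → ℝ} (hf : G.Flow f) {z0 : ℂ} (hz : z0 ∉ G.V)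
    (hoff : ∀ i, G.n i z0 ∈ slitPlane) : ∀ᶠ z in 𝓝 z0, G.F f z = G.F f z0 := by
  classical
  filter_upwards [G.F_near hf hz] with z h
  rw [h]; simp [hoff]

lemma F_near_on {f : ι → ℝ} (hf : G.Flow f) {z0 : ℂ} (hz : z0 ∉ G.V) {p : ι}
    (hp : G.n p z0 ∉ slitPlane) : ∀ᶠ z in 𝓝 z0,
      G.F f z = G.F f z0 - (if (G.n p z).im < 0 then 2 * π * f p else 0) := by
  classical
  filter_upwards [G.F_near hf hz] with z h
  rw [h, Finset.sum_eq_single p]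
  · simp only [hp, not_false_eq_true, true_and]
    split_ifs <;> ring
  · intro i _ hi
    rw [if_neg, mul_zero]
    rintro ⟨h1, _⟩
    exact hz (G.hX i p hi z0 h1 hp)
  · simp

/-- locally constant functions on intervals are constant -/
lemma const_of_locConst {g : ℝ → ℝ} {s : Set ℝ} (hs : IsOpen s) (hs' : IsPreconnected s)
    (h : ∀ t ∈ s, ∀ᶠ x in 𝓝 t, g x = g t) {x y : ℝ} (hx : x ∈ s) (hy : y ∈ s) : g x = g y := by
  have hd : ∀ t ∈ s, HasDerivAt g 0 t := fun t ht =>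
    (hasDerivAt_const t (g t)).congr_of_eventuallyEq (h t ht)
  exact hs.is_const_of_deriv_eq_zero hs'
    (fun t ht => (hd t ht).differentiableAt.differentiableWithinAt)
    (fun t ht => (hd t ht).deriv) hx hy

/-- parametrization of a piece -/
def par (p : ι) (s : ℝ) : ℂ := (G.u p * G.c p + s * G.a p) / (G.u p + s)

lemma u_add_ne (p : ι) {s : ℝ} (hs : 0 < s) : G.u p + s ≠ 0 := by
  intro h
  have h1 : G.u p = -(s : ℂ) := by linear_combination h
  have h2 := G.hu p
  rw [h1, norm_neg, norm_real, Real.norm_eq_abs, abs_of_pos hs] at h2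
  apply G.hu1 p
  rw [h1, h2]; simp

lemma n_par (p : ι) {s : ℝ} (hs : 0 < s) : ∃ t : ℝ, t < 0 ∧ G.n p (G.par p s) = t := by
  have h0 := G.u_add_ne p hs
  have e1 : G.c p - G.par p s = s * (G.c p - G.a p) / (G.u p + s) := by
    unfold par; field_simp; ring
  have e2 : G.a p - G.par p s = G.u p * (G.a p - G.c p) / (G.u p + s) := by
    unfold par; field_simp; ring
  refine ⟨-s * (normSq (G.c p - G.a p) / normSq (G.u p + s)), ?_, ?_⟩
  · have h1 : 0 < normSq (G.c p - G.a p) := normSq_pos.2 (sub_ne_zero.2 (G.hac p).symm)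
    have h2 : 0 < normSq (G.u p + s) := normSq_pos.2 h0
    have := mul_pos hs (div_pos h1 h2)
    linarith
  · unfold n nn
    rw [e1, e2]
    have hu : G.u p * (starRingEnd ℂ) (G.u p) = 1 := by
      rw [mul_conj, normSq_eq_norm_sq, G.hu p]; simp
    have h3 : (starRingEnd ℂ) (G.u p + s) ≠ 0 := (map_ne_zero _).2 h0
    push_cast
    rw [← mul_conj, ← mul_conj, map_div₀, map_mul]
    have e3 : (starRingEnd ℂ) (G.a p - G.c p) = - (starRingEnd ℂ) (G.c p - G.a p) := by
      rw [← map_neg]; congr 1; ring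
    rw [e3]
    field_simp
    linear_combination (-s * (G.c p - G.a p) * (starRingEnd ℂ) (G.c p - G.a p)) * hu

lemma par_slit (p : ι) {s : ℝ} (hs : 0 < s) : G.n p (G.par p s) ∉ slitPlane := by
  obtain ⟨t, ht, h⟩ := G.n_par p hs
  rw [h, mem_slitPlane_iff]; simp; exact ht.le

lemma par_notV (p : ι) {s : ℝ} (hs : 0 < s) : G.par p s ∉ G.V := by
  intro hV
  obtain ⟨t, ht, h⟩ := G.n_par p hs
  have h1 := G.hV p _ hV (G.par_slit p hs)
  have : G.n p (G.par p s) = 0 := by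
    rcases h1 with h1 | h1 <;> rw [h1] <;> simp [n, nn]
  rw [this] at h
  have : t = 0 := by exact_mod_cast h.symm
  linarith

lemma exists_par (p : ι) {z : ℂ} (hz : z ∉ G.V) (h : G.n p z ∉ slitPlane) :
    ∃ s : ℝ, 0 < s ∧ z = G.par p s := by
  have h0 := G.n_ne_zero (i := p) hz
  rw [mem_slitPlane_iff] at h
  push Not at h
  obtain ⟨hre, him⟩ := h
  have hre : (G.n p z).re < 0 := lt_of_le_of_ne hre fun h => h0 (Complex.ext h him)
  have hnr : G.n p z = (((G.n p z).re : ℝ) : ℂ) := Complex.ext (by simp) (by simp [him])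
  have h1 : G.a p - z ≠ 0 := sub_ne_zero.2 fun h => hz (h ▸ G.ha p)
  have h2 : 0 < normSq (G.a p - z) := normSq_pos.2 h1
  have hs : 0 < -(G.n p z).re / normSq (G.a p - z) := div_pos (by linarith) h2
  refine ⟨_, hs, ?_⟩
  unfold par
  rw [eq_div_iff (G.u_add_ne p hs)]
  push_cast
  rw [← hnr, ← mul_conj]
  have h3 : (starRingEnd ℂ) (G.a p - z) ≠ 0 := (map_ne_zero _).2 h1
  unfold n nn
  field_simp
  ring

lemma F_const {f : ι → ℝ} (hf : G.Flow f) (p : ι) {z w : ℂ} (hz : z ∉ G.V) (hw : w ∉ G.V)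
    (h1 : G.n p z ∉ slitPlane) (h2 : G.n p w ∉ slitPlane) : G.F f z = G.F f w := by
  obtain ⟨s, hs, rfl⟩ := G.exists_par p hz h1
  obtain ⟨t, ht, rfl⟩ := G.exists_par p hw h2
  refine const_of_locConst (g := fun s => G.F f (G.par p s)) (s := Ioi 0) isOpen_Ioi isPreconnected_Ioi ?_ hs ht
  intro r hr
  have hr : 0 < r := hr
  have hcont : ContinuousAt (G.par p) r := by
    unfold par
    have := G.u_add_ne p hr
    fun_prop (disch := assumption)
  filter_upwards [hcont.eventually (G.F_near_on hf (G.par_notV p hr) (G.par_slit p hr)),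
    Ioi_mem_nhds hr] with x hx hx0
  obtain ⟨t, ht, h⟩ := G.n_par p hx0
  rw [hx, if_neg, sub_zero]
  rw [h]; simp

end Drw
end Pln
end

section
namespace Pln
open Complex Filter Topology

/-- auxiliary: a piece polynomial along a small circle around its start -/
def hh (u K : ℂ) (t : ℝ) : ℂ := u * (1 - K * cexp (-(t * I)))

lemma hh_slit {u K : ℂ} (hu : ‖u‖ = 1) (hK : 1 < ‖K‖) {t : ℝ} (h : hh u K t ∉ slitPlane) :
    ∃ s : ℝ, 0 < s ∧ 0 < s + u.re ∧ u * K * cexp (-(t * I)) = u + s ∧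
      s ^ 2 + 2 * s * u.re + 1 = ‖K‖ ^ 2 ∧ 0 < s + 2 * u.re := by
  rw [mem_slitPlane_iff] at h
  push Not at h
  obtain ⟨hre, him⟩ := h
  set s := -(hh u K t).re with hs
  have hh1 : hh u K t = -(s : ℂ) := Complex.ext (by simp [hs]) (by simp [him])
  have h1 : u * K * cexp (-(t * I)) = u + s := by
    unfold hh at hh1; linear_combination -hh1
  have h2 : ‖u + s‖ ^ 2 = ‖K‖ ^ 2 := by
    rw [← h1, norm_mul, norm_mul, hu]
    have : ‖cexp (-(t * I))‖ = 1 := by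
      rw [show -((t : ℂ) * I) = ((-t : ℝ) : ℂ) * I by push_cast; ring, norm_exp_ofReal_mul_I]
    rw [this]; ring
  have h3 : u.re ^ 2 + u.im ^ 2 = 1 := by
    have : ‖u‖ ^ 2 = 1 := by rw [hu]; ring
    rw [← normSq_eq_norm_sq, normSq_apply] at this; linarith
  have h4 : s ^ 2 + 2 * s * u.re + 1 = ‖K‖ ^ 2 := by
    rw [← h2, ← normSq_eq_norm_sq, normSq_apply]; simp; linarith
  have h0 : 0 ≤ s := by rw [hs]; linarith
  have h5 : 0 < s * (s + 2 * u.re) := by nlinarith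
  have h6 : 0 < s := by
    rcases h0.lt_or_eq with h | h
    · exact h
    · rw [← h] at h5; simp at h5
  have h7 : 0 < s + 2 * u.re := by
    by_contra h; push Not at h; nlinarith
  exact ⟨s, h6, by linarith, h1, h4, h7⟩

lemma hh_exists {u K : ℂ} (hu : ‖u‖ = 1) (hK : 1 < ‖K‖) : ∃ t, hh u K t ∉ slitPlane := by
  set s : ℝ := -u.re + √(u.re ^ 2 + (‖K‖ ^ 2 - 1)) with hs
  have hp : 0 < ‖K‖ ^ 2 - 1 := by nlinarith
  have hsq : √(u.re ^ 2 + (‖K‖ ^ 2 - 1)) ^ 2 = u.re ^ 2 + (‖K‖ ^ 2 - 1) :=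
    Real.sq_sqrt (by positivity)
  have h0 : 0 < s := by
    have : u.re < √(u.re ^ 2 + (‖K‖ ^ 2 - 1)) := by
      apply Real.lt_sqrt_of_sq_lt; linarith
    linarith
  have h4 : s ^ 2 + 2 * s * u.re + 1 = ‖K‖ ^ 2 := by
    rw [hs]; linear_combination hsq
  have h3 : u.re ^ 2 + u.im ^ 2 = 1 := by
    have : ‖u‖ ^ 2 = 1 := by rw [hu]; ring
    rw [← normSq_eq_norm_sq, normSq_apply] at this; linarith
  have h2 : ‖u + s‖ ^ 2 = ‖K‖ ^ 2 := by
    rw [← h4, ← normSq_eq_norm_sq, normSq_apply]; simp; linarith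
  have h2' : ‖u + s‖ = ‖K‖ := (sq_eq_sq₀ (norm_nonneg _) (norm_nonneg _)).1 h2
  have hu0 : u ≠ 0 := by intro h; simp [h] at hu
  have hK0 : K ≠ 0 := by intro h; simp [h] at hK; linarith
  have h5 : ‖(u + s) / (u * K)‖ = 1 := by
    rw [norm_div, norm_mul, hu, h2', one_mul, div_self]; simpa using hK0
  refine ⟨-arg ((u + s) / (u * K)), ?_⟩
  have h6 := norm_mul_exp_arg_mul_I ((u + s) / (u * K))
  rw [h5] at h6
  have h7 : hh u K (-arg ((u + s) / (u * K))) = ((-s : ℝ) : ℂ) := by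
    unfold hh
    push_cast
    rw [neg_mul, neg_neg]
    simp only [ofReal_one, one_mul] at h6
    rw [h6]; field_simp; ring
  rw [h7, mem_slitPlane_iff]; simp; exact h0.le

lemma hh_unique {u K : ℂ} (hu : ‖u‖ = 1) (hK : 1 < ‖K‖) {t t' : ℝ} (h : hh u K t ∉ slitPlane)
    (h' : hh u K t' ∉ slitPlane) : cexp (t * I) = cexp (t' * I) := by
  obtain ⟨s, h1, h2, h3, h4, h5⟩ := hh_slit hu hK h
  obtain ⟨s', h1', h2', h3', h4', h5'⟩ := hh_slit hu hK h'
  have : (s - s') * (s + s' + 2 * u.re) = 0 := by linear_combination h4 - h4'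
  have hss : s = s' := by
    rcases mul_eq_zero.1 this with h | h <;> linarith
  subst hss
  have hu0 : u ≠ 0 := by intro h; simp [h] at hu
  have hK0 : K ≠ 0 := by intro h; simp [h] at hK; linarith
  have := mul_left_cancel₀ (mul_ne_zero hu0 hK0) (h3.trans h3'.symm)
  rw [Complex.exp_neg, Complex.exp_neg] at this
  exact inv_injective this

lemma hh_im {u K : ℂ} (hu : ‖u‖ = 1) (hK : 1 < ‖K‖) {t0 : ℝ} (h : hh u K t0 ∉ slitPlane) :
    ∀ᶠ t in 𝓝 t0, (t0 < t → 0 < (hh u K t).im) ∧ (t < t0 → (hh u K t).im < 0) := by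
  obtain ⟨s, h1, h2, h3, h4, h5⟩ := hh_slit hu hK h
  have e1 : ∀ t, (hh u K t).im = 2 * Real.sin ((t - t0) / 2) *
      ((s + u.re) * Real.cos ((t - t0) / 2) + u.im * Real.sin ((t - t0) / 2)) := by
    intro t
    have e2 : hh u K t = u - (u + s) * cexp (((-(t - t0) : ℝ) : ℂ) * I) := by
      rw [← h3, mul_assoc (u * K), ← Complex.exp_add]
      unfold hh
      rw [show -((t0 : ℂ) * I) + ((-(t - t0) : ℝ) : ℂ) * I = -(t * I) by push_cast; ring]
      ring
    rw [e2, sub_im, mul_im, exp_ofReal_mul_I_re, exp_ofReal_mul_I_im]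
    simp only [add_re, add_im, ofReal_re, ofReal_im, Real.sin_neg, Real.cos_neg]
    set y := (t - t0) / 2 with hy
    have : t - t0 = 2 * y := by rw [hy]; ring
    rw [this, Real.sin_two_mul, Real.cos_two_mul]
    have := Real.sin_sq_add_cos_sq y
    linear_combination (-2 * u.im) * this
  have hc : ContinuousAt (fun t : ℝ => (s + u.re) * Real.cos ((t - t0) / 2) + u.im * Real.sin ((t - t0) / 2)) t0 := by
    fun_prop
  have hpos := (continuousAt_const (y := (0 : ℝ))).eventually_lt hc (by simp; exact h2)
  filter_upwards [hpos, Ioo_mem_nhds (show t0 - 1 < t0 by linarith) (show t0 < t0 + 1 by linarith)]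
    with t ht hI
  rw [e1]
  constructor
  · intro hlt
    have : 0 < Real.sin ((t - t0) / 2) :=
      Real.sin_pos_of_pos_of_lt_pi (by linarith) (by linarith [hI.2, Real.pi_gt_three])
    positivity
  · intro hlt
    have : Real.sin ((t - t0) / 2) < 0 :=
      Real.sin_neg_of_neg_of_neg_pi_lt (by linarith) (by linarith [hI.1, Real.pi_gt_three])
    nlinarith

/-- circle around `v` -/
def cir (v : ℂ) (r t : ℝ) : ℂ := v + r * cexp (t * I)

lemma nn_cir_a (a c u : ℂ) {r : ℝ} (hr : 0 < r) (t : ℝ) :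
    nn a c u (cir a r t) = (r ^ 2 : ℝ) * hh u ((c - a) / r) t := by
  have hr' : (r : ℂ) ≠ 0 := by exact_mod_cast hr.ne'
  have e : (starRingEnd ℂ) (cexp (t * I)) = cexp (-(t * I)) := by
    rw [← Complex.exp_conj]; simp
  have e2 : cexp (t * I) * cexp (-(t * I)) = 1 := by rw [← Complex.exp_add]; simp
  unfold nn cir hh
  rw [show a - (a + r * cexp (t * I)) = -(r * cexp (t * I)) by ring, map_neg, map_mul, e, conj_ofReal]
  push_cast
  field_simp
  linear_combination (u * r) * e2

lemma nn_cir_c (a c u : ℂ) {r : ℝ} (hr : 0 < r) (t : ℝ) :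
    nn a c u (cir c r t) = (starRingEnd ℂ) ((r ^ 2 : ℝ) * hh ((starRingEnd ℂ) u) ((a - c) / r) t) := by
  rw [← nn_cir_a c a _ hr t]
  unfold nn
  simp only [map_mul, Complex.conj_conj]
  ring

lemma conj_slit (z : ℂ) : (starRingEnd ℂ) z ∈ slitPlane ↔ z ∈ slitPlane := by
  simp [mem_slitPlane_iff]

lemma mul_slit {r : ℝ} (hr : 0 < r) (z : ℂ) : (r : ℂ) * z ∈ slitPlane ↔ z ∈ slitPlane := by
  simp only [mem_slitPlane_iff, re_ofReal_mul, im_ofReal_mul]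
  simp [hr, hr.ne']

namespace Drw
variable {ι : Type} [Fintype ι] (G : Drw ι)

/-- incidence -/
def Inc (p : ι) (v : ℂ) : Prop := G.a p = v ∨ G.c p = v

/-- a good radius around `v` -/
def Good (v : ℂ) (r : ℝ) : Prop := 0 < r ∧ (∀ p, r < ‖G.c p - G.a p‖) ∧
  (∀ w ∈ G.V, ∀ t, cir v r t ≠ w) ∧ (∀ p, ¬ G.Inc p v → ∀ t, G.n p (cir v r t) ∈ slitPlane)

lemma dist_cir (v : ℂ) {r : ℝ} (hr : 0 < r) (t : ℝ) : dist (cir v r t) v = r := by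
  simp [cir, abs_of_pos hr]

lemma exists_good {v : ℂ} (hv : v ∈ G.V) : ∃ r, G.Good v r := by
  have h1 : ∀ᶠ r in 𝓝[>] (0 : ℝ), ∀ p, r < ‖G.c p - G.a p‖ := by
    rw [eventually_all]
    intro p
    have : 0 < ‖G.c p - G.a p‖ := norm_pos_iff.2 (sub_ne_zero.2 (G.hac p).symm)
    exact nhdsWithin_le_nhds (Iio_mem_nhds this)
  have h2 : ∀ᶠ r in 𝓝[>] (0 : ℝ), ∀ w ∈ G.V, r ≠ dist w v := by
    rw [Filter.eventually_all_finset]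
    intro w hw
    rcases eq_or_ne w v with rfl | h
    · filter_upwards [self_mem_nhdsWithin] with r hr
      rw [dist_self]; exact ne_of_gt hr
    · have : 0 < dist w v := dist_pos.2 h
      filter_upwards [nhdsWithin_le_nhds (Iio_mem_nhds this)] with r hr
      exact ne_of_lt hr
  have h3 : ∀ᶠ r in 𝓝[>] (0 : ℝ), ∀ p, ¬ G.Inc p v → ∀ z, dist z v = r → G.n p z ∈ slitPlane := by
    rw [eventually_all]
    intro p
    by_cases hp : G.Inc p v
    · simp [hp]
    · have hs : G.n p v ∈ slitPlane := by
        by_contra h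
        rcases G.hV p v hv h with h | h
        · exact hp (Or.inl h.symm)
        · exact hp (Or.inr h.symm)
      have := (nn_cont (G.a p) (G.c p) (G.u p)).continuousAt.eventually (isOpen_slitPlane.mem_nhds hs)
      obtain ⟨ε, he, h⟩ := Metric.eventually_nhds_iff.1 this
      filter_upwards [nhdsWithin_le_nhds (Iio_mem_nhds he)] with r hr _ z hz
      exact h (hz ▸ hr)
  obtain ⟨r, hr, h1, h2, h3⟩ := (eventually_mem_nhdsWithin.and (h1.and (h2.and h3))).exists
  refine ⟨r, hr, h1, ?_, ?_⟩
  · rintro w hw t rfl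
    exact h2 _ hw (dist_cir v hr t).symm
  · intro p hp t
    exact h3 p hp _ (dist_cir v hr t)

lemma hit {v : ℂ} {r : ℝ} (hg : G.Good v r) {p : ι} (hp : G.Inc p v) :
    (∃ t, G.n p (cir v r t) ∉ slitPlane) ∧
    (∀ t t', G.n p (cir v r t) ∉ slitPlane → G.n p (cir v r t') ∉ slitPlane →
      cexp (t * I) = cexp (t' * I)) ∧
    (∀ t0, G.n p (cir v r t0) ∉ slitPlane → ∀ᶠ t in 𝓝 t0,
      (t0 < t → if G.a p = v then 0 < (G.n p (cir v r t)).im else (G.n p (cir v r t)).im < 0) ∧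
      (t < t0 → if G.a p = v then (G.n p (cir v r t)).im < 0 else 0 < (G.n p (cir v r t)).im)) := by
  obtain ⟨hr, h1, -, -⟩ := hg
  have hr2 : 0 < r ^ 2 := by positivity
  have hK : 1 < ‖(G.c p - G.a p) / r‖ := by
    rw [norm_div, norm_real, Real.norm_eq_abs, abs_of_pos hr, one_lt_div hr]; exact h1 p
  have hK' : 1 < ‖(G.a p - G.c p) / r‖ := by
    rw [norm_div, norm_real, Real.norm_eq_abs, abs_of_pos hr, one_lt_div hr, norm_sub_rev]; exact h1 p
  have hu := G.hu p
  have hu' : ‖(starRingEnd ℂ) (G.u p)‖ = 1 := by simpa using hu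
  unfold n
  by_cases ha : G.a p = v
  · subst ha
    simp only [if_true, nn_cir_a _ _ _ hr, mul_slit hr2, im_ofReal_mul]
    refine ⟨hh_exists hu hK, fun t t' => hh_unique hu hK, fun t0 h => ?_⟩
    filter_upwards [hh_im hu hK h] with t ht
    exact ⟨fun h => mul_pos hr2 (ht.1 h), fun h => mul_neg_of_pos_of_neg hr2 (ht.2 h)⟩
  · have hc : G.c p = v := hp.resolve_left ha
    subst hc
    simp only [ha, if_false, nn_cir_c _ _ _ hr, conj_slit, mul_slit hr2, conj_im, im_ofReal_mul]
    refine ⟨hh_exists hu' hK', fun t t' => hh_unique hu' hK', fun t0 h => ?_⟩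
    filter_upwards [hh_im hu' hK' h] with t ht
    exact ⟨fun h => by have := mul_pos hr2 (ht.1 h); linarith,
      fun h => by have := mul_neg_of_pos_of_neg hr2 (ht.2 h); linarith⟩

/-- value of the flow potential to the left of a directed piece -/
def val (f : ι → ℝ) (d : ι × Bool) : ℝ :=
  G.F f (G.par d.1 1) - (if d.2 then 0 else 2 * π * f d.1)

/-- the dart of `p` leaving `v` -/
def outd (p : ι) (v : ℂ) : ι × Bool := (p, decide (G.a p = v))
/-- the dart of `p` entering `v` -/
def ind (p : ι) (v : ℂ) : ι × Bool := (p, !decide (G.a p = v))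

lemma cir_cont (v : ℂ) (r : ℝ) : Continuous (cir v r) := by unfold cir; fun_prop

lemma near_hit {f : ι → ℝ} (hf : G.Flow f) {v : ℂ} {r : ℝ} (hg : G.Good v r) {p : ι}
    (hp : G.Inc p v) {t0 : ℝ} (h0 : G.n p (cir v r t0) ∉ slitPlane) :
    ∀ᶠ t in 𝓝 t0, (t0 < t → G.F f (cir v r t) = G.val f (G.outd p v)) ∧
      (t < t0 → G.F f (cir v r t) = G.val f (G.ind p v)) := by
  have hnV : cir v r t0 ∉ G.V := fun h => hg.2.2.1 _ h t0 rfl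
  have e0 : G.F f (cir v r t0) = G.F f (G.par p 1) :=
    G.F_const hf p hnV (G.par_notV p one_pos) h0 (G.par_slit p one_pos)
  filter_upwards [(G.hit hg hp).2.2 t0 h0,
    (cir_cont v r).continuousAt.eventually (G.F_near_on hf hnV h0)] with t h1 h2
  rw [h2, e0]
  unfold val outd ind
  refine ⟨fun h => ?_, fun h => ?_⟩
  · have := h1.1 h
    by_cases ha : G.a p = v
    · simp only [ha, if_true] at this
      simp [ha, this.le]
    · simp only [ha, if_false] at this
      simp [ha, this]
  · have := h1.2 h
    by_cases ha : G.a p = v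
    · simp only [ha, if_true] at this
      simp [ha, this]
    · simp only [ha, if_false] at this
      simp [ha, this.le]

lemma between {f : ι → ℝ} (hf : G.Flow f) {v : ℂ} {r : ℝ} (hg : G.Good v r) {p q : ι}
    (hp : G.Inc p v) (hq : G.Inc q v) {t0 t1 : ℝ} (ht : t0 < t1)
    (h0 : G.n p (cir v r t0) ∉ slitPlane) (h1 : G.n q (cir v r t1) ∉ slitPlane)
    (hb : ∀ t ∈ Ioo t0 t1, ∀ i, G.n i (cir v r t) ∈ slitPlane) :
    G.val f (G.outd p v) = G.val f (G.ind q v) := by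
  have hc : ∀ x ∈ Ioo t0 t1, ∀ y ∈ Ioo t0 t1, G.F f (cir v r x) = G.F f (cir v r y) := by
    intro x hx y hy
    refine const_of_locConst (g := fun t => G.F f (cir v r t)) isOpen_Ioo isPreconnected_Ioo ?_ hx hy
    intro t hti
    exact (cir_cont v r).continuousAt.eventually
      (G.F_near_off hf (fun h => hg.2.2.1 _ h t rfl) (hb t hti))
  have a1 : ∃ x ∈ Ioo t0 t1, G.F f (cir v r x) = G.val f (G.outd p v) := by
    have := nhdsWithin_le_nhds (s := Ioi t0) (G.near_hit hf hg hp h0)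
    obtain ⟨x, hx, hx2⟩ := (Filter.Eventually.and (Ioo_mem_nhdsGT ht) this).exists
    exact ⟨x, hx, hx2.1 hx.1⟩
  have a2 : ∃ x ∈ Ioo t0 t1, G.F f (cir v r x) = G.val f (G.ind q v) := by
    have := nhdsWithin_le_nhds (s := Iio t1) (G.near_hit hf hg hq h1)
    obtain ⟨x, hx, hx2⟩ := (Filter.Eventually.and (Ioo_mem_nhdsLT ht) this).exists
    exact ⟨x, hx, hx2.2 hx.2⟩
  obtain ⟨x, hx, ex⟩ := a1
  obtain ⟨y, hy, ey⟩ := a2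
  rw [← ex, ← ey]; exact hc x hx y hy

lemma exp_inj {t t' b : ℝ} (h : cexp (t * I) = cexp (t' * I)) (ht : t ∈ Ioc b (b + 2 * π))
    (ht' : t' ∈ Ioc b (b + 2 * π)) : t = t' := by
  obtain ⟨k, hk⟩ := Complex.exp_eq_exp_iff_exists_int.1 h
  have h2 : (t : ℂ) * I = (t' + k * (2 * π)) * I := by rw [hk]; ring
  have h3 : t = t' + k * (2 * π) := by exact_mod_cast mul_right_cancel₀ I_ne_zero h2
  have hpi := Real.pi_pos
  have h4 : (k : ℝ) < 1 := by
    by_contra hc; push Not at hc; nlinarith [ht.2, ht'.1]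
  have h5 : (-1 : ℝ) < k := by
    by_contra hc; push Not at hc; nlinarith [ht.1, ht'.2]
  have : k = 0 := by
    have h4 : k < 1 := by exact_mod_cast h4
    have h5 : -1 < k := by exact_mod_cast h5
    omega
  simp [h3, this]

lemma exp_rep (t b : ℝ) : ∃ t' ∈ Ioc b (b + 2 * π), cexp (t' * I) = cexp (t * I) := by
  refine ⟨toIocMod Real.two_pi_pos b t, toIocMod_mem_Ioc _ _ _, ?_⟩
  rw [Complex.exp_eq_exp_iff_exists_int]
  refine ⟨-toIocDiv Real.two_pi_pos b t, ?_⟩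
  have := toIocMod_add_toIocDiv_zsmul Real.two_pi_pos b t
  have h2 : ((toIocMod Real.two_pi_pos b t + toIocDiv Real.two_pi_pos b t • (2 * π) : ℝ) : ℂ) = t := by
    rw [this]
  rw [zsmul_eq_mul] at h2
  push_cast at h2 ⊢
  rw [← h2]; ring

theorem next {v : ℂ} (hv : v ∈ G.V) {p : ι} (hp : G.Inc p v) (h2 : ∃ q, q ≠ p ∧ G.Inc q v) :
    (∃ q, q ≠ p ∧ G.Inc q v ∧ ∀ f, G.Flow f → G.val f (G.outd p v) = G.val f (G.ind q v)) ∧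
    (∃ q, q ≠ p ∧ G.Inc q v ∧ ∀ f, G.Flow f → G.val f (G.outd q v) = G.val f (G.ind p v)) := by
  classical
  obtain ⟨r, hg⟩ := G.exists_good hv
  obtain ⟨t0, h0⟩ := (G.hit hg hp).1
  have hcir : ∀ t t' : ℝ, cexp (t * I) = cexp (t' * I) → cir v r t = cir v r t' := by
    intro t t' h; simp [cir, h]
  have hrep : ∀ q, ∃ t, G.Inc q v → t ∈ Ioc t0 (t0 + 2 * π) ∧ G.n q (cir v r t) ∉ slitPlane := by
    intro q
    by_cases hq : G.Inc q v
    · obtain ⟨t, ht⟩ := (G.hit hg hq).1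
      obtain ⟨t', h', e⟩ := exp_rep t t0
      exact ⟨t', fun _ => ⟨h', by rw [hcir _ _ e]; exact ht⟩⟩
    · exact ⟨0, fun h => absurd h hq⟩
  choose τ hτ using hrep
  have hper : cexp (((t0 + 2 * π : ℝ) : ℂ) * I) = cexp (t0 * I) := by
    rw [Complex.exp_eq_exp_iff_exists_int]; exact ⟨1, by push_cast; ring⟩
  have h0' : G.n p (cir v r (t0 + 2 * π)) ∉ slitPlane := by rw [hcir _ _ hper]; exact h0
  have hpi := Real.pi_pos
  set S := Finset.univ.filter fun q => q ≠ p ∧ G.Inc q v with hS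
  have hSne : S.Nonempty := by
    obtain ⟨q, hq⟩ := h2
    exact ⟨q, by simp [hS, hq]⟩
  have hlt : ∀ q ∈ S, τ q < t0 + 2 * π := by
    intro q hq
    obtain ⟨hq1, hq2⟩ := (Finset.mem_filter.1 hq).2
    obtain ⟨h3, h4⟩ := hτ q hq2
    refine lt_of_le_of_ne h3.2 fun he => ?_
    rw [he] at h4
    exact hg.2.2.1 _ (G.hX q p hq1 _ h4 h0') _ rfl
  -- any hit in the window comes from S
  have hhit : ∀ t ∈ Ioo t0 (t0 + 2 * π), ∀ i, G.n i (cir v r t) ∉ slitPlane → i ∈ S ∧ t = τ i := by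
    intro t ht i hi
    have hinc : G.Inc i v := by
      by_contra h; exact hi (hg.2.2.2 i h t)
    have hip : i ≠ p := by
      rintro rfl
      have := (G.hit hg hinc).2.1 _ _ hi h0'
      have := exp_inj this ⟨ht.1, ht.2.le⟩ ⟨by linarith, le_refl _⟩
      linarith [ht.2]
    refine ⟨by simp [hS, hip, hinc], ?_⟩
    exact exp_inj ((G.hit hg hinc).2.1 _ _ hi (hτ i hinc).2) ⟨ht.1, ht.2.le⟩ (hτ i hinc).1
  constructor
  · obtain ⟨q, hq, hmin⟩ := S.exists_min_image τ hSne
    obtain ⟨hq1, hq2⟩ := (Finset.mem_filter.1 hq).2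
    refine ⟨q, hq1, hq2, fun f hf => ?_⟩
    refine G.between hf hg hp hq2 (hτ q hq2).1.1 h0 (hτ q hq2).2 fun t ht i => ?_
    by_contra hi
    obtain ⟨h3, h4⟩ := hhit t ⟨ht.1, ht.2.trans (hlt q hq)⟩ i hi
    have := hmin i h3
    linarith [ht.2]
  · obtain ⟨q, hq, hmax⟩ := S.exists_max_image τ hSne
    obtain ⟨hq1, hq2⟩ := (Finset.mem_filter.1 hq).2
    refine ⟨q, hq1, hq2, fun f hf => ?_⟩
    refine G.between hf hg hq2 hp (hlt q hq) (hτ q hq2).2 h0' fun t ht i => ?_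
    by_contra hi
    obtain ⟨h3, h4⟩ := hhit t ⟨(hτ q hq2).1.1.trans ht.1, ht.2⟩ i hi
    have := hmax i h3
    linarith [ht.1]

end Drw
end Pln
end

section
namespace Pln
open Complex Filter Topology

namespace Drw
variable {ι : Type} [Fintype ι] (G : Drw ι)

/-- boundary map -/
def bd : (ι → ℝ) →ₗ[ℝ] (G.V → ℝ) where
  toFun f v := ∑ i, f i * ((if G.c i = v then 1 else 0) - (if G.a i = v then 1 else 0))
  map_add' f g := by
    ext v; simp only [Pi.add_apply, add_mul, Finset.sum_add_distrib]
  map_smul' r f := by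
    ext v; simp only [Pi.smul_apply, smul_eq_mul, Finset.mul_sum, RingHom.id_apply, mul_assoc]

/-- `val` as a linear functional -/
def valL (d : ι × Bool) : (ι → ℝ) →ₗ[ℝ] ℝ where
  toFun f := G.val f d
  map_add' f g := by
    unfold val F
    simp only [Pi.add_apply, add_mul, Finset.sum_add_distrib]
    split_ifs <;> ring
  map_smul' r f := by
    unfold val F
    simp only [Pi.smul_apply, smul_eq_mul, RingHom.id_apply, mul_assoc, ← Finset.mul_sum]
    split_ifs <;> ring

lemma flow_of_ker {f : ι → ℝ} (h : f ∈ LinearMap.ker G.bd) : G.Flow f := by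
  intro v
  by_cases hv : v ∈ G.V
  · exact congrFun (LinearMap.mem_ker.1 h) ⟨v, hv⟩
  · refine Finset.sum_eq_zero fun i _ => ?_
    rw [if_neg, if_neg]
    · ring
    · rintro rfl; exact hv (G.ha i)
    · rintro rfl; exact hv (G.hc i)

lemma finrank_range_lt [Nonempty ι] : Module.finrank ℝ (LinearMap.range G.bd) + 1 ≤ G.V.card := by
  have h1 : LinearMap.range G.bd ≠ ⊤ := by
    intro h
    obtain ⟨i⟩ := (inferInstance : Nonempty ι)
    have hm : (fun v : G.V => if (v : ℂ) = G.a i then (1 : ℝ) else 0) ∈ LinearMap.range G.bd := by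
      rw [h]; trivial
    obtain ⟨f, hf⟩ := hm
    have h2 : ∑ v : G.V, G.bd f v = 0 := by
      change ∑ v : G.V, ∑ i, f i * ((if G.c i = v then (1 : ℝ) else 0) - (if G.a i = v then 1 else 0)) = 0
      rw [Finset.sum_comm]
      refine Finset.sum_eq_zero fun j _ => ?_
      rw [← Finset.mul_sum, Finset.sum_sub_distrib]
      rw [Finset.sum_coe_sort G.V (fun v => if G.c j = v then (1 : ℝ) else 0),
        Finset.sum_coe_sort G.V (fun v => if G.a j = v then (1 : ℝ) else 0)]
      simp [G.ha j, G.hc j]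
    rw [hf, Finset.sum_coe_sort G.V (fun v => if v = G.a i then (1 : ℝ) else 0)] at h2
    simp [G.ha i] at h2
  have := Submodule.finrank_lt h1
  simpa using this

theorem count [Nonempty ι] (k : ℕ)
    (hk : ∀ d, ∃ s : Finset (ι × Bool), k ≤ s.card ∧ ∀ d' ∈ s, ∀ f, G.Flow f →
      G.val f d' = G.val f d) :
    k * (Fintype.card ι + 2) ≤ 2 * Fintype.card ι + k * G.V.card := by
  classical
  set Z := LinearMap.ker G.bd with hZ
  let κ : ι × Bool → (Z →ₗ[ℝ] ℝ) := fun d => (G.valL d).comp Z.subtype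
  have hκ : ∀ d (f : Z), κ d f = G.val f d := fun d f => rfl
  set Q : Finset (Z →ₗ[ℝ] ℝ) := Finset.univ.image κ with hQ
  have hrn := LinearMap.finrank_range_add_finrank_ker G.bd
  rw [Module.finrank_fintype_fun_eq_card] at hrn
  rw [← hZ] at hrn
  have hlt := G.finrank_range_lt
  -- dimension bound
  let Ψ : (Z × ℝ) →ₗ[ℝ] (Q → ℝ) :=
    { toFun := fun x q => q.1 x.1 + x.2
      map_add' := by intro x y; ext q; simp; ring
      map_smul' := by intro r x; ext q; simp; ring }
  have hinj : Function.Injective Ψ := by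
    rw [← LinearMap.ker_eq_bot, LinearMap.ker_eq_bot']
    rintro ⟨f, t⟩ h
    have h1 : ∀ d, G.val f d + t = 0 := by
      intro d
      have := congrFun h ⟨κ d, by simp [hQ]⟩
      simpa [Ψ, hκ] using this
    have hf : f = 0 := by
      ext p
      have a1 := h1 (p, true)
      have a2 := h1 (p, false)
      unfold val at a1 a2
      simp at a1 a2
      have : 2 * π * (f : ι → ℝ) p = 0 := by linarith
      have hpi := Real.pi_pos
      simpa [hpi.ne'] using this
    subst hf
    obtain ⟨i⟩ := (inferInstance : Nonempty ι)
    have := h1 (i, true)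
    have e : G.val (((0 : Z) : ι → ℝ)) (i, true) = 0 := (κ (i, true)).map_zero
    rw [e, zero_add] at this
    rw [this]; rfl
  have hdim := LinearMap.finrank_le_finrank_of_injective hinj
  rw [Module.finrank_prod, Module.finrank_fintype_fun_eq_card, Module.finrank_self, Fintype.card_coe] at hdim
  -- class sizes
  have hcl : k * Q.card ≤ 2 * Fintype.card ι := by
    have e : Fintype.card (ι × Bool) = 2 * Fintype.card ι := by simp [mul_comm]
    rw [← e, ← Finset.card_univ, Finset.card_eq_sum_card_image κ, mul_comm, ← smul_eq_mul]
    refine Finset.card_nsmul_le_sum _ _ _ fun q hq => ?_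
    obtain ⟨d, -, rfl⟩ := Finset.mem_image.1 hq
    obtain ⟨s, hs, h⟩ := hk d
    refine hs.trans (Finset.card_le_card fun d' hd' => ?_)
    simp only [Finset.mem_filter, Finset.mem_univ, true_and]
    ext f
    exact h d' hd' f (G.flow_of_ker f.2)
  have : k * (Fintype.card ι + 2) ≤ k * (Q.card + G.V.card) := Nat.mul_le_mul_left _ (by omega)
  linarith

end Drw
end Pln
end

section
namespace Pln
open Complex Filter Topology

/-- every directed edge is equivalent to two further ones -/
lemma three {ι : Type} (a c : ι → ℂ) (hac : ∀ i, a i ≠ c i)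
    (hs : ∀ i j, i ≠ j → ∀ v w, v ≠ w → (a i = v ∨ c i = v) → (a i = w ∨ c i = w) →
      (a j = v ∨ c j = v) → ¬ (a j = w ∨ c j = w))
    (R : ι × Bool → ι × Bool → Prop) (hR : ∀ d, R d d) (hRs : ∀ d d', R d d' → R d' d)
    (hn : ∀ i v, (a i = v ∨ c i = v) →
      (∃ j, j ≠ i ∧ (a j = v ∨ c j = v) ∧ R (i, decide (a i = v)) (j, !decide (a j = v))) ∧
      (∃ j, j ≠ i ∧ (a j = v ∨ c j = v) ∧ R (j, decide (a j = v)) (i, !decide (a i = v))))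
    (d : ι × Bool) : ∃ s : Finset (ι × Bool), s.card = 3 ∧ ∀ d' ∈ s, R d' d := by
  classical
  obtain ⟨i, b⟩ := d
  have key : ∀ v w, v ≠ w → (a i = v ∨ c i = v) → (a i = w ∨ c i = w) →
      b = decide (a i = v) → b = !decide (a i = w) →
      ∃ s : Finset (ι × Bool), s.card = 3 ∧ ∀ d' ∈ s, R d' (i, b) := by
    intro v w hvw hv hw e1 e2
    obtain ⟨j, hj, hjv, h1⟩ := (hn i v hv).1
    obtain ⟨k, hk, hkw, h2⟩ := (hn i w hw).2
    have hjk : j ≠ k := by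
      rintro rfl
      exact hs i j hj.symm v w hvw hv hw hjv hkw
    refine ⟨{(i, b), (j, !decide (a j = v)), (k, decide (a k = w))}, ?_, ?_⟩
    · rw [Finset.card_eq_three]
      refine ⟨_, _, _, ?_, ?_, ?_, rfl⟩
      · intro h; exact hj (congrArg Prod.fst h).symm
      · intro h; exact hk (congrArg Prod.fst h).symm
      · intro h; exact hjk (congrArg Prod.fst h)
    · intro d' hd'
      simp only [Finset.mem_insert, Finset.mem_singleton] at hd'
      rcases hd' with rfl | rfl | rfl
      · exact hR _
      · rw [e1]; exact hRs _ _ h1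
      · rw [e2]; exact h2
  cases b
  · refine key (c i) (a i) (hac i).symm (Or.inr rfl) (Or.inl rfl) ?_ ?_ <;> simp [hac i]
  · refine key (a i) (c i) (hac i) (Or.inl rfl) (Or.inr rfl) ?_ ?_ <;> simp [hac i]

theorem arc_bound {ι : Type} [Fintype ι] [Nonempty ι] (G : Drw ι)
    (hs : ∀ i j, i ≠ j → ∀ v w, v ≠ w → G.Inc i v → G.Inc i w → G.Inc j v → ¬ G.Inc j w)
    (hd : ∀ i v, G.Inc i v → ∃ j, j ≠ i ∧ G.Inc j v) :
    Fintype.card ι + 6 ≤ 3 * G.V.card := by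
  have hmem : ∀ i v, G.Inc i v → v ∈ G.V := by
    rintro i v (h | h)
    · exact h ▸ G.ha i
    · exact h ▸ G.hc i
  have := G.count 3 (fun d => by
    obtain ⟨s, h1, h2⟩ := three G.a G.c G.hac hs
      (fun d d' => ∀ f, G.Flow f → G.val f d = G.val f d') (fun d f _ => rfl)
      (fun d d' h f hf => (h f hf).symm)
      (fun i v hi => G.next (hmem i v hi) hi (hd i v hi)) d
    exact ⟨s, h1.ge, h2⟩)
  omega

theorem bend_bound {ι : Type} [Fintype ι] [Nonempty ι] (G : Drw (ι × Bool)) (a b c : ι → ℂ)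
    (e1 : ∀ i, G.a (i, false) = a i) (e2 : ∀ i, G.c (i, false) = b i)
    (e3 : ∀ i, G.a (i, true) = b i) (e4 : ∀ i, G.c (i, true) = c i)
    (hba : ∀ i j, b i ≠ a j) (hbc : ∀ i j, b i ≠ c j) (hbb : ∀ i j, i ≠ j → b i ≠ b j)
    (hac : ∀ i, a i ≠ c i)
    (hs : ∀ i j, i ≠ j → ∀ v w, v ≠ w → (a i = v ∨ c i = v) → (a i = w ∨ c i = w) →
      (a j = v ∨ c j = v) → ¬ (a j = w ∨ c j = w))
    (hd : ∀ i v, (a i = v ∨ c i = v) → ∃ j, j ≠ i ∧ (a j = v ∨ c j = v)) (n : ℕ)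
    (hV : G.V.card ≤ n + Fintype.card ι) :
    Fintype.card ι + 6 ≤ 3 * n := by
  classical
  have hmem : ∀ i v, G.Inc i v → v ∈ G.V := by
    rintro i v (h | h)
    · exact h ▸ G.ha i
    · exact h ▸ G.hc i
  -- incidences at a bend
  have hincb : ∀ i j h, G.Inc (j, h) (b i) → j = i := by
    intro i j h hi
    by_contra hne
    cases h
    · rcases hi with hi | hi
      · rw [e1] at hi; exact hba _ _ hi.symm
      · rw [e2] at hi; exact hbb _ _ hne hi
    · rcases hi with hi | hi
      · rw [e3] at hi; exact hbb _ _ hne hi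
      · rw [e4] at hi; exact hbc _ _ hi.symm
  have hbend : ∀ i, ∀ f, G.Flow f → ∀ σ h, G.val f ((i, h), σ) = G.val f ((i, false), σ) := by
    intro i f hf σ h
    have hp : G.Inc (i, false) (b i) := Or.inr (e2 i)
    have hq : G.Inc (i, true) (b i) := Or.inl (e3 i)
    obtain ⟨⟨⟨j, h1⟩, hj, hij, hv⟩, ⟨⟨j', h1'⟩, hj', hij', hv'⟩⟩ :=
      G.next (hmem _ _ hp) hp ⟨(i, true), by simp, hq⟩
    obtain rfl := hincb _ _ _ hij
    obtain rfl := hincb _ _ _ hij'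
    have t1 : h1 = true := by cases h1 <;> simp_all
    have t2 : h1' = true := by cases h1' <;> simp_all
    subst t1 t2
    have v1 := hv f hf
    have v2 := hv' f hf
    simp only [Drw.outd, Drw.ind, e1, e3, (hba _ _).symm, decide_true, decide_false, Bool.not_true, Bool.not_false] at v1 v2
    cases h
    · rfl
    · cases σ
      · exact v1.symm
      · exact v2
  -- pieces at original vertices
  have hinc : ∀ i v, (a i = v ∨ c i = v) → G.Inc (i, !decide (a i = v)) v ∧
      decide (G.a (i, !decide (a i = v)) = v) = decide (a i = v) := by
    intro i v hv
    by_cases ha : a i = v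
    · simp [ha, Drw.Inc, e1]
    · have hc := hv.resolve_left ha
      have : b i ≠ v := hc ▸ hbc i i
      simp [ha, Drw.Inc, e3, e4, hc, this]
  have hback : ∀ j h v i, (a i = v ∨ c i = v) → G.Inc (j, h) v →
      (a j = v ∨ c j = v) ∧ h = !decide (a j = v) := by
    intro j h v i hi hj
    have hbv : b j ≠ v := by
      rcases hi with rfl | rfl
      · exact hba _ _
      · exact hbc _ _
    cases h
    · have : a j = v := by
        rcases hj with hj | hj
        · rwa [e1] at hj
        · rw [e2] at hj; exact absurd hj hbv
      simp [this]
    · have : c j = v := by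
        rcases hj with hj | hj
        · rw [e3] at hj; exact absurd hj hbv
        · rwa [e4] at hj
      have h2 : a j ≠ v := this ▸ hac j
      simp [this, h2]
  have hnext : ∀ i v, (a i = v ∨ c i = v) →
      (∃ j, j ≠ i ∧ (a j = v ∨ c j = v) ∧ ∀ f, G.Flow f → ∀ h h',
        G.val f ((i, h), decide (a i = v)) = G.val f ((j, h'), !decide (a j = v))) ∧
      (∃ j, j ≠ i ∧ (a j = v ∨ c j = v) ∧ ∀ f, G.Flow f → ∀ h h',
        G.val f ((j, h), decide (a j = v)) = G.val f ((i, h'), !decide (a i = v))) := by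
    intro i v hi
    obtain ⟨j, hji, hj⟩ := hd i v hi
    obtain ⟨hp, hp2⟩ := hinc i v hi
    obtain ⟨hq, -⟩ := hinc j v hj
    obtain ⟨⟨⟨k, h1⟩, hk, hik, hv⟩, ⟨⟨k', h1'⟩, hk', hik', hv'⟩⟩ :=
      G.next (hmem _ _ hp) hp ⟨_, fun h => hji (congrArg Prod.fst h), hq⟩
    obtain ⟨g1, g2⟩ := hback _ _ _ i hi hik
    obtain ⟨g1', g2'⟩ := hback _ _ _ i hi hik'
    subst g2 g2'
    refine ⟨⟨k, ?_, g1, fun f hf h h' => ?_⟩, ⟨k', ?_, g1', fun f hf h h' => ?_⟩⟩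
    · rintro rfl; exact hk rfl
    · have := hv f hf
      unfold Drw.outd Drw.ind at this
      rw [hp2, (hinc k v g1).2, hbend i f hf, hbend k f hf] at this
      rw [hbend i f hf _ h, hbend k f hf _ h', this]
    · rintro rfl; exact hk' rfl
    · have := hv' f hf
      unfold Drw.outd Drw.ind at this
      rw [hp2, (hinc k' v g1').2, hbend k' f hf, hbend i f hf] at this
      rw [hbend k' f hf _ h, hbend i f hf _ h', this]
  have := G.count 6 (fun d => by
    obtain ⟨⟨i, h⟩, σ⟩ := d
    obtain ⟨s, h1, h2⟩ := three a c hac hs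
      (fun d d' => ∀ f, G.Flow f → ∀ h h', G.val f ((d.1, h), d.2) = G.val f ((d'.1, h'), d'.2))
      (fun d f hf h h' => by rw [hbend _ f hf, hbend _ f hf d.2 h'])
      (fun d d' h f hf h1 h2 => (h f hf h2 h1).symm) hnext (i, σ)
    refine ⟨(s ×ˢ Finset.univ).image (fun x : (ι × Bool) × Bool => ((x.1.1, x.2), x.1.2)), ?_, ?_⟩
    · rw [Finset.card_image_of_injective, Finset.card_product, h1]
      · simp
      · rintro ⟨⟨x, y⟩, z⟩ ⟨⟨x', y'⟩, z'⟩ h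
        simp only [Prod.mk.injEq] at h ⊢
        tauto
    · intro d' hd' f hf
      obtain ⟨⟨⟨x, y⟩, z⟩, hx, rfl⟩ := Finset.mem_image.1 hd'
      exact h2 (x, y) (Finset.mem_product.1 hx).1 f hf z h)
  rw [Fintype.card_prod, Fintype.card_bool] at this
  omega

end Pln
end

section
namespace Pln
open Complex Filter Topology

/-- identification of the plane with `ℂ` -/
def phi (x : Pt) : ℂ := ⟨x 0, x 1⟩

lemma phi_inj : Function.Injective phi := by
  intro x y h
  have h0 := congrArg Complex.re h
  have h1 := congrArg Complex.im h
  ext i; fin_cases i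
  · exact h0
  · exact h1

lemma phi_surj (z : ℂ) : ∃ x, phi x = z := ⟨!₂[z.re, z.im], by simp [phi]⟩

/-- dot product seen from `z` -/
def dt (a z c : Pt) : ℝ := (a 0 - z 0) * (c 0 - z 0) + (a 1 - z 1) * (c 1 - z 1)

/-- cross product seen from `z` -/
def cr (a z c : Pt) : ℝ := (a 0 - z 0) * (c 1 - z 1) - (a 1 - z 1) * (c 0 - z 0)

lemma angle_eq (a z c : Pt) :
    ∠ a z c = Real.arccos (dt a z c / √(dt a z c ^ 2 + cr a z c ^ 2)) := by
  unfold EuclideanGeometry.angle InnerProductGeometry.angle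
  have h1 : inner ℝ (a -ᵥ z) (c -ᵥ z) = dt a z c := by
    simp [PiLp.inner_apply, Fin.sum_univ_two, dt]; ring
  have h2 : ‖a -ᵥ z‖ * ‖c -ᵥ z‖ = √(dt a z c ^ 2 + cr a z c ^ 2) := by
    rw [EuclideanSpace.norm_eq, EuclideanSpace.norm_eq, ← Real.sqrt_mul (by positivity)]
    congr 1
    simp [Fin.sum_univ_two, dt, cr]; ring
  rw [h1, h2]

lemma mem_line {a c x : Pt} (hac : a ≠ c) :
    x ∈ affineSpan ℝ ({a, c} : Set Pt) ↔ cr a x c = 0 := by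
  rw [mem_affineSpan_pair_iff_exists_lineMap_eq]
  constructor
  · rintro ⟨r, rfl⟩
    simp [cr, AffineMap.lineMap_apply]; ring
  · intro h
    have h2 : (c 0 - a 0) ^ 2 + (c 1 - a 1) ^ 2 ≠ 0 := by
      intro h3
      apply hac
      ext i; fin_cases i <;> simp <;> nlinarith [sq_nonneg (c 0 - a 0), sq_nonneg (c 1 - a 1)]
    unfold cr at h
    refine ⟨((x 0 - a 0) * (c 0 - a 0) + (x 1 - a 1) * (c 1 - a 1)) / ((c 0 - a 0) ^ 2 + (c 1 - a 1) ^ 2), ?_⟩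
    ext i; fin_cases i
    · simp [AffineMap.lineMap_apply]; field_simp; linear_combination ((c 1 - a 1)) * h
    · simp [AffineMap.lineMap_apply]; field_simp; linear_combination (-(c 0 - a 0)) * h

lemma sss {a c x y : Pt} (hac : a ≠ c) :
    (affineSpan ℝ ({a, c} : Set Pt)).SSameSide x y ↔ 0 < cr a x c * cr a y c := by
  have ha : a ∈ affineSpan ℝ ({a, c} : Set Pt) := left_mem_affineSpan_pair ℝ a c
  rw [AffineSubspace.sSameSide_iff_exists_left ha, mem_line hac, mem_line hac]
  constructor
  · rintro ⟨hx, hy, p, hp, hr⟩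
    obtain ⟨r, rfl⟩ := mem_affineSpan_pair_iff_exists_lineMap_eq.1 hp
    have hxa : x -ᵥ a ≠ 0 := by
      intro h; rw [vsub_eq_zero_iff_eq] at h; subst h; simp [cr] at hx
    have hyp : y -ᵥ AffineMap.lineMap a c r ≠ 0 := by
      intro h; rw [vsub_eq_zero_iff_eq] at h; subst h; simp [cr, AffineMap.lineMap_apply] at hy
      apply hy; ring
    obtain ⟨s, t, hs, ht, hst⟩ := hr.exists_pos hxa hyp
    have h0 := congrArg (fun v => v 0) hst
    have h1 := congrArg (fun v => v 1) hst
    simp [AffineMap.lineMap_apply] at h0 h1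
    have : s * cr a x c = t * cr a y c := by
      unfold cr
      linear_combination -(c 1 - a 1) * h0 + (c 0 - a 0) * h1
    have h3 : 0 < cr a x c ^ 2 := by positivity
    have : 0 < t * (cr a x c * cr a y c) := by
      rw [show t * (cr a x c * cr a y c) = s * cr a x c ^ 2 by linear_combination (-cr a x c) * this]; positivity
    exact (pos_iff_pos_of_mul_pos this).1 ht
  · intro h
    have hx : cr a x c ≠ 0 := by intro h'; simp [h'] at h
    have hy : cr a y c ≠ 0 := by intro h'; simp [h'] at h
    refine ⟨hx, hy, ?_⟩
    have h2 : (c 0 - a 0) ^ 2 + (c 1 - a 1) ^ 2 ≠ 0 := by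
      intro h3
      apply hac
      ext i; fin_cases i <;> simp <;> nlinarith [sq_nonneg (c 0 - a 0), sq_nonneg (c 1 - a 1)]
    set μ := cr a y c / cr a x c with hμ
    have hμ0 : 0 < μ := by
      rw [hμ, show cr a y c / cr a x c = cr a x c * cr a y c / cr a x c ^ 2 by field_simp]
      positivity
    have hyx : cr a y c = μ * cr a x c := by rw [hμ]; field_simp
    set l := (((y 0 - a 0) - μ * (x 0 - a 0)) * (c 0 - a 0) + ((y 1 - a 1) - μ * (x 1 - a 1)) * (c 1 - a 1)) / ((c 0 - a 0) ^ 2 + (c 1 - a 1) ^ 2) with hl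
    refine ⟨AffineMap.lineMap a c l, AffineMap.lineMap_mem_affineSpan_pair l a c, ?_⟩
    have : y -ᵥ AffineMap.lineMap a c l = μ • (x -ᵥ a) := by
      unfold cr at hyx
      clear_value μ
      ext i; fin_cases i
      · simp [AffineMap.lineMap_apply, hl]; field_simp; linear_combination (-(c 1 - a 1)) * hyx
      · simp [AffineMap.lineMap_apply, hl]; field_simp; linear_combination ((c 0 - a 0)) * hyx
    rw [this]
    exact SameRay.sameRay_pos_smul_right _ hμ0

lemma nn_re (a c z : Pt) : (phi c - phi z) * (starRingEnd ℂ) (phi a - phi z) = ⟨dt a z c, cr a z c⟩ := by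
  apply Complex.ext <;> simp [phi, dt, cr] <;> ring

lemma arc_mem {α : ℝ} {e : Pt × Pt × Pt} (he : IsArcEdge α e) :
    ∃ u : ℂ, ‖u‖ = 1 ∧ u ≠ -1 ∧ ∀ z : Pt, nn (phi e.1) (phi e.2.2) u (phi z) ∉ slitPlane →
      z ∈ arcImage e := by
  obtain ⟨a, b, c⟩ := e
  obtain ⟨hac, hb, -⟩ := he
  simp only at hac hb ⊢
  rw [mem_line hac] at hb
  set w : ℂ := ⟨dt a b c, cr a b c⟩ with hw
  have hw0 : w ≠ 0 := by intro h; exact hb (congrArg Complex.im h)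
  have hn0 : (0:ℝ) < ‖w‖ := norm_pos_iff.2 hw0
  refine ⟨-((starRingEnd ℂ) w) / ‖w‖, ?_, ?_, ?_⟩
  · rw [norm_div, norm_neg, RCLike.norm_conj]; simp [hn0.ne']
  · intro h
    rw [div_eq_iff (by exact_mod_cast hn0.ne')] at h
    have := congrArg Complex.im h
    simp [hw] at this
    exact hb this
  · intro z hz
    rw [nn, mul_assoc, nn_re, Complex.mem_slitPlane_iff] at hz
    push Not at hz
    have e1 : -((starRingEnd ℂ) w) / (‖w‖ : ℂ) * (⟨dt a z c, cr a z c⟩ : ℂ) =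
      ((‖w‖⁻¹ : ℝ) : ℂ) * (-((starRingEnd ℂ) w) * ⟨dt a z c, cr a z c⟩) := by
      push_cast; ring
    rw [e1, Complex.re_ofReal_mul, Complex.im_ofReal_mul] at hz
    obtain ⟨h1, h2⟩ := hz
    have hi : 0 < ‖w‖⁻¹ := inv_pos.2 hn0
    have h1 := nonpos_of_mul_nonpos_right h1 hi
    have h2 := (mul_eq_zero.1 h2).resolve_left hi.ne'
    simp [hw] at h1 h2
    have hN : 0 < dt a b c ^ 2 + cr a b c ^ 2 := by positivity
    have hab : a ≠ z → c ≠ z → dt a z c ^ 2 + cr a z c ^ 2 ≠ 0 := by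
      intro n1 n2 h
      have : ((a 0 - z 0) ^ 2 + (a 1 - z 1) ^ 2) * ((c 0 - z 0) ^ 2 + (c 1 - z 1) ^ 2) = 0 := by
        rw [← h]; unfold dt cr; ring
      rcases mul_eq_zero.1 this with h | h
      · apply n1; ext i; fin_cases i <;> simp <;> nlinarith [sq_nonneg (a 0 - z 0), sq_nonneg (a 1 - z 1)]
      · apply n2; ext i; fin_cases i <;> simp <;> nlinarith [sq_nonneg (c 0 - z 0), sq_nonneg (c 1 - z 1)]
    by_cases n1 : a = z
    · left; simp [n1]
    by_cases n2 : c = z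
    · left; simp [n2]
    have hz0 := hab n1 n2
    right
    set t := (dt a b c * dt a z c + cr a b c * cr a z c) / (dt a b c ^ 2 + cr a b c ^ 2) with ht
    have g1 : dt a z c = t * dt a b c := by
      rw [ht]; field_simp; linear_combination (cr a b c) * h2
    have g2 : cr a z c = t * cr a b c := by
      rw [ht]; field_simp; linear_combination (-dt a b c) * h2
    have ht0 : 0 ≤ t := by rw [ht]; apply div_nonneg _ hN.le; linarith
    clear_value t
    have ht0 : 0 < t := by
      rcases ht0.lt_or_eq with h | h
      · exact h
      · subst h; simp [g1, g2] at hz0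
    refine ⟨(sss hac).2 ?_, ?_⟩
    · simp only
      rw [g2]; have : 0 < cr a b c ^ 2 := by positivity
      nlinarith
    · simp only
      rw [angle_eq, angle_eq, g1, g2]
      congr 1
      rw [show (t * dt a b c) ^ 2 + (t * cr a b c) ^ 2 = t ^ 2 * (dt a b c ^ 2 + cr a b c ^ 2) by ring,
        Real.sqrt_mul (by positivity), Real.sqrt_sq ht0.le, mul_div_mul_left _ _ ht0.ne']

lemma induct (P : Finset Pt → Finset (Pt × Pt × Pt) → Prop)
    (H1 : ∀ V E, P V E → ∀ e ∈ E, e.1 ≠ e.2.2 ∧ e.1 ∈ V ∧ e.2.2 ∈ V)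
    (H2 : ∀ V E, P V E → ∀ e ∈ E, ∀ f ∈ E, e ≠ f → edgeEndpoints e ≠ edgeEndpoints f)
    (H3 : ∀ V E E' v, P V E → E' ⊆ E → (∀ e ∈ E', v ∉ edgeEndpoints e) → P (V.erase v) E')
    (H4 : ∀ V E, P V E → E.Nonempty → (∀ e ∈ E, ∀ v ∈ edgeEndpoints e, ∃ f ∈ E, f ≠ e ∧ v ∈ edgeEndpoints f) →
      E.card + 6 ≤ 3 * V.card) :
    ∀ n, 3 ≤ n → ∀ V E, V.card = n → P V E → E.card ≤ 3 * n - 6 := by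
  classical
  intro n hn
  induction n, hn using Nat.le_induction with
  | base =>
    intro V E hV hP
    rcases E.eq_empty_or_nonempty with rfl | hne
    · simp
    by_cases h : ∀ e ∈ E, ∀ v ∈ edgeEndpoints e, ∃ f ∈ E, f ≠ e ∧ v ∈ edgeEndpoints f
    · have := H4 V E hP hne h; omega
    push Not at h
    obtain ⟨e, he, v, hv, hf⟩ := h
    have hP' := H3 V E (E.erase e) v hP (Finset.erase_subset _ _) (fun f hf' =>
      hf f (Finset.mem_of_mem_erase hf') (Finset.ne_of_mem_erase hf'))
    have hvV : v ∈ V := by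
      have := H1 V E hP e he
      rcases hv with rfl | rfl
      · exact this.2.1
      · exact this.2.2
    have hV' : (V.erase v).card = 2 := by rw [Finset.card_erase_of_mem hvV, hV]
    have : (E.erase e).card ≤ 1 := by
      rw [Finset.card_le_one]
      have key : ∀ f ∈ E.erase e, edgeEndpoints f = ((V.erase v : Finset Pt) : Set Pt) := by
        intro f hf
        obtain ⟨h1, h2, h3⟩ := H1 _ _ hP' f hf
        have : ({f.1, f.2.2} : Finset Pt) = V.erase v := by
          apply Finset.eq_of_subset_of_card_le
          · intro x hx; simp only [Finset.mem_insert, Finset.mem_singleton] at hx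
            rcases hx with rfl | rfl <;> assumption
          · rw [hV', Finset.card_pair h1]
        rw [← this]; simp [edgeEndpoints]
      intro f hf g hg
      by_contra hne
      exact H2 _ _ hP' f hf g hg hne ((key f hf).trans (key g hg).symm)
    rw [Finset.card_erase_of_mem he] at this
    omega
  | succ n hn ih =>
    intro V E hV hP
    rcases E.eq_empty_or_nonempty with rfl | hne
    · simp
    by_cases h : ∀ e ∈ E, ∀ v ∈ edgeEndpoints e, ∃ f ∈ E, f ≠ e ∧ v ∈ edgeEndpoints f
    · have := H4 V E hP hne h; omega
    push Not at h
    obtain ⟨e, he, v, hv, hf⟩ := h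
    have hP' := H3 V E (E.erase e) v hP (Finset.erase_subset _ _) (fun f hf' =>
      hf f (Finset.mem_of_mem_erase hf') (Finset.ne_of_mem_erase hf'))
    have hvV : v ∈ V := by
      have := H1 V E hP e he
      rcases hv with rfl | rfl
      · exact this.2.1
      · exact this.2.2
    have := ih _ _ (by rw [Finset.card_erase_of_mem hvV, hV]; rfl) hP'
    rw [Finset.card_erase_of_mem he] at this
    omega

end Pln
end

section
namespace Pln
open Complex Filter Topology

lemma pair_eq {a c a' c' : Pt} {v w : ℂ} (hvw : v ≠ w) (h1 : phi a = v ∨ phi c = v)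
    (h2 : phi a = w ∨ phi c = w) (h3 : phi a' = v ∨ phi c' = v) (h4 : phi a' = w ∨ phi c' = w) :
    ({a, c} : Set Pt) = {a', c'} := by
  obtain ⟨x, rfl⟩ := phi_surj v
  obtain ⟨y, rfl⟩ := phi_surj w
  simp only [phi_inj.eq_iff] at h1 h2 h3 h4
  have hxy : x ≠ y := fun h => hvw (by rw [h])
  have key : ∀ p q : Pt, (p = x ∨ q = x) → (p = y ∨ q = y) → ({p, q} : Set Pt) = {x, y} := by
    rintro p q (rfl | rfl) (rfl | rfl)
    · exact absurd rfl hxy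
    · rfl
    · exact Set.pair_comm _ _
    · exact absurd rfl hxy
  rw [key _ _ h1 h2, key _ _ h3 h4]

lemma deg2 {E : Finset (Pt × Pt × Pt)}
    (h : ∀ e ∈ E, ∀ v ∈ edgeEndpoints e, ∃ f ∈ E, f ≠ e ∧ v ∈ edgeEndpoints f) (i : E) (v : ℂ)
    (hv : phi i.1.1 = v ∨ phi i.1.2.2 = v) :
    ∃ j : E, j ≠ i ∧ (phi j.1.1 = v ∨ phi j.1.2.2 = v) := by
  obtain ⟨x, rfl⟩ := phi_surj v
  simp only [phi_inj.eq_iff] at hv ⊢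
  obtain ⟨f, hf, hne, hx⟩ := h i.1 i.2 x (by
    rcases hv with h | h
    · exact Or.inl h.symm
    · exact Or.inr h.symm)
  refine ⟨⟨f, hf⟩, fun h => hne (congrArg Subtype.val h), ?_⟩
  rcases hx with h | h
  · exact Or.inl h.symm
  · exact Or.inr h.symm

theorem arc_upper (α : ℝ) (n : ℕ) (hn : 3 ≤ n) (V : Finset Pt) (E : Finset (Pt × Pt × Pt))
    (hV : V.card = n) (hP : IsPlaneArcGraph α V E) : E.card ≤ 3 * n - 6 := by
  classical
  refine induct (IsPlaneArcGraph α) ?_ ?_ ?_ ?_ n hn V E hV hP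
  · rintro V E ⟨⟨h1, -⟩, -⟩ e he
    exact ⟨(h1 e he).1.1, (h1 e he).2⟩
  · rintro V E ⟨-, h⟩
    exact h
  · rintro V E E' v ⟨⟨h1, h2, h3, h4⟩, h5⟩ hE hv
    refine ⟨⟨fun e he => ⟨(h1 e (hE he)).1, ?_, ?_⟩, fun e he f hf => h2 e (hE he) f (hE hf),
      fun e he x hx => h3 e (hE he) x (Finset.mem_of_mem_erase hx),
      fun e he f hf => h4 e (hE he) f (hE hf)⟩, fun e he f hf => h5 e (hE he) f (hE hf)⟩
    · exact Finset.mem_erase.2 ⟨fun h => hv e he (Or.inl h.symm), (h1 e (hE he)).2.1⟩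
    · exact Finset.mem_erase.2 ⟨fun h => hv e he (Or.inr h.symm), (h1 e (hE he)).2.2⟩
  · rintro V E ⟨⟨h1, h2, h3, h4⟩, h5⟩ hne hd
    choose u hu1 hu2 hu3 using fun e : E => arc_mem (h1 e.1 e.2).1
    let G : Drw E :=
      { V := V.image phi
        a := fun e => phi e.1.1
        c := fun e => phi e.1.2.2
        u := u
        ha := fun e => Finset.mem_image_of_mem _ (h1 e.1 e.2).2.1
        hc := fun e => Finset.mem_image_of_mem _ (h1 e.1 e.2).2.2
        hac := fun e h => (h1 e.1 e.2).1.1 (phi_inj h)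
        hu := hu1
        hu1 := hu2
        hV := fun e v hv hz => by
          obtain ⟨x, hx, rfl⟩ := Finset.mem_image.1 hv
          rcases h3 e.1 e.2 x hx (hu3 e x hz) with h | h
          · left; rw [h]
          · right; rw [h]
        hX := fun i j hij z hi hj => by
          obtain ⟨x, rfl⟩ := phi_surj z
          have := h4 i.1 i.2 j.1 j.2 (fun h => hij (Subtype.ext h)) ⟨hu3 i x hi, hu3 j x hj⟩
          apply Finset.mem_image_of_mem
          rcases this.1 with h | h
          · rw [h]; exact (h1 i.1 i.2).2.1
          · rw [h]; exact (h1 i.1 i.2).2.2 }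
    have : Nonempty E := hne.to_subtype
    have := arc_bound G (fun i j hij v w hvw a1 a2 a3 a4 =>
      h5 i.1 i.2 j.1 j.2 (fun h => hij (Subtype.ext h)) (pair_eq hvw a1 a2 a3 a4))
      (fun i v hv => deg2 hd i v hv)
    rw [Fintype.card_coe] at this
    exact this.trans (Nat.mul_le_mul_left _ Finset.card_image_le)

lemma seg_mem {a b z : Pt} (hab : a ≠ b) (h : nn (phi a) (phi b) 1 (phi z) ∉ slitPlane) :
    z ∈ segment ℝ a b := by
  rw [nn, mul_assoc, nn_re, one_mul, Complex.mem_slitPlane_iff] at h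
  push Not at h
  obtain ⟨h1, h2⟩ := h
  simp only at h1 h2
  obtain ⟨r, rfl⟩ := mem_affineSpan_pair_iff_exists_lineMap_eq.1 ((mem_line hab).2 h2)
  rw [segment_eq_image_lineMap]
  refine ⟨r, ?_, rfl⟩
  have hN : 0 < (b 0 - a 0) ^ 2 + (b 1 - a 1) ^ 2 := by
    by_contra h3
    apply hab
    ext i; fin_cases i <;> simp <;> nlinarith [sq_nonneg (b 0 - a 0), sq_nonneg (b 1 - a 1)]
  have : r * (1 - r) * ((b 0 - a 0) ^ 2 + (b 1 - a 1) ^ 2) = - dt a (AffineMap.lineMap a b r) b := by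
    simp [dt, AffineMap.lineMap_apply]; ring
  have h4 : 0 ≤ r * (1 - r) := by
    by_contra h5
    nlinarith
  constructor <;> nlinarith

lemma seg_inter {a b c z : Pt} (h : ∀ r : ℝ, 0 < r → c - b ≠ r • (a - b))
    (hba : b ≠ a)
    (h1 : z ∈ segment ℝ a b) (h2 : z ∈ segment ℝ b c) : z = b := by
  rw [segment_symm, segment_eq_image_lineMap] at h1
  rw [segment_eq_image_lineMap] at h2
  obtain ⟨s, ⟨hs, -⟩, rfl⟩ := h1
  obtain ⟨t, ⟨ht, -⟩, h2⟩ := h2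
  simp only [AffineMap.lineMap_apply, vsub_eq_sub, vadd_eq_add, add_left_inj] at h2 ⊢
  rcases hs.lt_or_eq with hs | rfl
  · rcases ht.lt_or_eq with ht | rfl
    · refine absurd ?_ (h (t⁻¹ * s) (by positivity))
      rw [mul_smul, ← h2, smul_smul, inv_mul_cancel₀ ht.ne', one_smul]
    · simp only [zero_smul] at h2
      rw [← h2, zero_add]
  · simp

lemma bend_fix {α : ℝ} (h0 : 0 < α) {e : Pt × Pt × Pt} (he : IsBendEdge α e) :
    ∃ b, b ≠ e.1 ∧ b ≠ e.2.2 ∧ segment ℝ e.1 b ⊆ bendImage e ∧ segment ℝ b e.2.2 ⊆ bendImage e ∧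
      ∀ z ∈ segment ℝ e.1 b, z ∈ segment ℝ b e.2.2 → z = b := by
  obtain ⟨a, b, c⟩ := e
  obtain ⟨hac, ha⟩ := he
  simp only [bendImage] at *
  by_cases hb : b ≠ a ∧ b ≠ c
  · refine ⟨b, hb.1, hb.2, subset_union_left, subset_union_right, fun z h1 h2 => ?_⟩
    refine seg_inter (fun r hr h => ?_) hb.1 h1 h2
    have : ∠ a b c = 0 := by
      unfold EuclideanGeometry.angle
      rw [InnerProductGeometry.angle_eq_zero_iff]
      exact ⟨sub_ne_zero.2 hb.1.symm, r, hr, h⟩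
    linarith
  · have hsub : segment ℝ a c ⊆ segment ℝ a b ∪ segment ℝ b c := by
      by_cases h : b = a
      · subst h; exact subset_union_right
      · have : b = c := by by_contra h'; exact hb ⟨h, h'⟩
        subst this; exact subset_union_left
    have hm : midpoint ℝ a c ∈ segment ℝ a c := midpoint_mem_segment a c
    refine ⟨midpoint ℝ a c, ?_, ?_, ?_, ?_, ?_⟩
    · exact fun h => hac ((midpoint_eq_left_iff ℝ).1 h)
    · exact fun h => hac ((midpoint_eq_right_iff ℝ).1 h)
    · exact ((convex_segment a c).segment_subset (left_mem_segment ℝ a c) hm).trans hsub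
    · exact ((convex_segment a c).segment_subset hm (right_mem_segment ℝ a c)).trans hsub
    · intro z h1 h2
      refine seg_inter (fun r hr h => ?_) (fun h => hac ((midpoint_eq_left_iff ℝ).1 h)) h1 h2
      apply hac
      have e1 : c - midpoint ℝ a c = (1/2 : ℝ) • (c - a) := by
        rw [right_sub_midpoint]; simp
      have e2 : a - midpoint ℝ a c = -((1/2 : ℝ) • (c - a)) := by
        rw [left_sub_midpoint, ← smul_neg]; simp
      rw [e1, e2, ← smul_neg, smul_neg, smul_neg, eq_neg_iff_add_eq_zero, smul_smul, ← add_smul, smul_eq_zero] at h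
      rcases h with h | h
      · linarith
      · exact (sub_eq_zero.1 h).symm

theorem bend_upper (α : ℝ) (hα : 0 < α) (n : ℕ) (hn : 3 ≤ n) (V : Finset Pt) (E : Finset (Pt × Pt × Pt))
    (hV : V.card = n) (hP : IsPlaneBendGraph α V E) : E.card ≤ 3 * n - 6 := by
  classical
  refine induct (IsPlaneBendGraph α) ?_ ?_ ?_ ?_ n hn V E hV hP
  · rintro V E ⟨⟨h1, -⟩, -⟩ e he
    exact ⟨(h1 e he).1.1, (h1 e he).2⟩
  · rintro V E ⟨-, h⟩
    exact h
  · rintro V E E' v ⟨⟨h1, h2, h3, h4⟩, h5⟩ hE hv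
    refine ⟨⟨fun e he => ⟨(h1 e (hE he)).1, ?_, ?_⟩, fun e he f hf => h2 e (hE he) f (hE hf),
      fun e he x hx => h3 e (hE he) x (Finset.mem_of_mem_erase hx),
      fun e he f hf => h4 e (hE he) f (hE hf)⟩, fun e he f hf => h5 e (hE he) f (hE hf)⟩
    · exact Finset.mem_erase.2 ⟨fun h => hv e he (Or.inl h.symm), (h1 e (hE he)).2.1⟩
    · exact Finset.mem_erase.2 ⟨fun h => hv e he (Or.inr h.symm), (h1 e (hE he)).2.2⟩
  · rintro V E ⟨⟨h1, h2, h3, h4⟩, h5⟩ hne hd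
    choose b hba hbc hsa hsc hin using fun e : E => bend_fix hα (h1 e.1 e.2).1
    have hbI : ∀ e, b e ∈ bendImage e.1 := fun e => hsa e (right_mem_segment ℝ _ _)
    have hbV : ∀ e, b e ∉ V := by
      intro e h
      rcases h3 e.1 e.2 _ h (hbI e) with h | h
      · exact hba e h
      · exact hbc e h
    have hIV : ∀ i j : E, i ≠ j → ∀ z, z ∈ bendImage i.1 → z ∈ bendImage j.1 → z ∈ V := by
      intro i j hij z hi hj
      have := h4 i.1 i.2 j.1 j.2 (fun h => hij (Subtype.ext h)) ⟨hi, hj⟩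
      rcases this.1 with h | h
      · rw [h]; exact (h1 i.1 i.2).2.1
      · rw [h]; exact (h1 i.1 i.2).2.2
    have hbb : ∀ i j, i ≠ j → b i ≠ b j := by
      intro i j hij h
      exact hbV i (hIV i j hij _ (hbI i) (h ▸ hbI j))
    let W : Finset ℂ := V.image phi ∪ Finset.univ.image (fun e : E => phi (b e))
    have hWV : ∀ x ∈ V, phi x ∈ W := fun x hx => Finset.mem_union_left _ (Finset.mem_image_of_mem _ hx)
    have hWb : ∀ e, phi (b e) ∈ W := fun e => Finset.mem_union_right _
      (Finset.mem_image.2 ⟨e, Finset.mem_univ _, rfl⟩)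
    have hWI : ∀ i : E, ∀ v ∈ W, ∀ x, phi x = v → x ∈ bendImage i.1 → x = i.1.1 ∨ x = i.1.2.2 ∨ x = b i := by
      intro i v hv x hx hxi
      rcases Finset.mem_union.1 hv with h | h
      · obtain ⟨y, hy, rfl⟩ := Finset.mem_image.1 h
        obtain rfl := phi_inj hx
        rcases h3 i.1 i.2 _ hy hxi with h | h
        · exact Or.inl h
        · exact Or.inr (Or.inl h)
      · obtain ⟨j, -, rfl⟩ := Finset.mem_image.1 h
        obtain rfl := phi_inj hx
        by_cases hij : i = j
        · subst hij; simp
        · exact absurd (hIV i j hij _ hxi (hbI j)) (hbV j)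
    let A : E × Bool → Pt := fun p => if p.2 then b p.1 else p.1.1.1
    let C : E × Bool → Pt := fun p => if p.2 then p.1.1.2.2 else b p.1
    have hAC : ∀ p, A p ≠ C p := by
      rintro ⟨i, h⟩
      cases h
      · exact (hba i).symm
      · exact hbc i
    have hI : ∀ p, segment ℝ (A p) (C p) ⊆ bendImage p.1.1 := by
      rintro ⟨i, h⟩
      cases h
      · exact hsa i
      · exact hsc i
    let G : Drw (E × Bool) :=
      { V := W
        a := fun p => phi (A p)
        c := fun p => phi (C p)
        u := fun _ => 1
        ha := by
          rintro ⟨i, h⟩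
          cases h
          · exact hWV _ (h1 i.1 i.2).2.1
          · exact hWb i
        hc := by
          rintro ⟨i, h⟩
          cases h
          · exact hWb i
          · exact hWV _ (h1 i.1 i.2).2.2
        hac := fun p h => hAC p (phi_inj h)
        hu := by simp
        hu1 := fun _ h => by
          have := congrArg Complex.re h
          norm_num at this
        hV := fun p v hv hz => by
          obtain ⟨x, rfl⟩ := phi_surj v
          have hs := seg_mem (hAC p) hz
          have hx := hWI p.1 _ hv x rfl (hI p hs)
          rw [phi_inj.eq_iff, phi_inj.eq_iff]
          obtain ⟨i, h⟩ := p
          cases h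
          · rcases hx with hx | hx | hx
            · exact Or.inl hx
            · exact Or.inr (hin i x hs (hx ▸ right_mem_segment ℝ _ _))
            · exact Or.inr hx
          · rcases hx with hx | hx | hx
            · exact Or.inl (hin i x (hx ▸ left_mem_segment ℝ _ _) hs)
            · exact Or.inr hx
            · exact Or.inl hx
        hX := fun p q hpq z hp hq => by
          obtain ⟨x, rfl⟩ := phi_surj z
          have hsp := seg_mem (hAC p) hp
          have hsq := seg_mem (hAC q) hq
          by_cases hij : p.1 = q.1
          · have : x = b p.1 := by
              obtain ⟨i, h⟩ := p
              obtain ⟨j, h'⟩ := q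
              simp only at hij
              subst hij
              cases h <;> cases h'
              · exact absurd rfl hpq
              · exact hin i x hsp hsq
              · exact hin i x hsq hsp
              · exact absurd rfl hpq
            rw [this]; exact hWb _
          · exact hWV _ (hIV _ _ hij x (hI p hsp) (hI q hsq)) }
    have : Nonempty E := hne.to_subtype
    have := bend_bound G (fun e => phi e.1.1) (fun e => phi (b e)) (fun e => phi e.1.2.2)
      (fun _ => rfl) (fun _ => rfl) (fun _ => rfl) (fun _ => rfl)
      (fun i j h => hbV i (phi_inj h ▸ (h1 j.1 j.2).2.1))
      (fun i j h => hbV i (phi_inj h ▸ (h1 j.1 j.2).2.2))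
      (fun i j hij h => hbb i j hij (phi_inj h))
      (fun e h => (h1 e.1 e.2).1.1 (phi_inj h))
      (fun i j hij v w hvw a1 a2 a3 a4 =>
      h5 i.1 i.2 j.1 j.2 (fun h => hij (Subtype.ext h)) (pair_eq hvw a1 a2 a3 a4))
      (fun i v hv => deg2 hd i v hv) V.card
      ((Finset.card_union_le _ _).trans (add_le_add Finset.card_image_le Finset.card_image_le))
    rw [Fintype.card_coe] at this
    exact this

end Pln
end

section
namespace Pln
open Complex Filter Topology

/-- the `i`-th vertex of the construction -/
def pt (i : ℕ) : Pt := !₂[(i : ℝ), 0]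

@[simp] lemma pt_zero (i : ℕ) : pt i 0 = i := by simp [pt]
@[simp] lemma pt_one (i : ℕ) : pt i 1 = 0 := by simp [pt]

lemma pt_inj : Function.Injective pt := by
  intro i j h
  have := congrArg (fun v : Pt => v 0) h
  simpa using this

/-- the page of the edge `(i,j)` -/
def sg (n : ℕ) (p : ℕ × ℕ) : ℝ := if p.2 = n - 1 ∧ p.1 ≠ 0 then -1 else 1

/-- the index set of the edges -/
def Ix (n : ℕ) : Finset (ℕ × ℕ) :=
  ((Finset.Icc 1 (n - 1)).image (fun j => (0, j)) ∪ (Finset.Icc 1 (n - 2)).image (fun j => (j, n - 1))) ∪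
    (Finset.Icc 1 (n - 3)).image (fun j => (j, j + 1))

lemma mem_Ix {n : ℕ} {p : ℕ × ℕ} : p ∈ Ix n ↔ (p.1 = 0 ∧ 1 ≤ p.2 ∧ p.2 ≤ n - 1) ∨
    (p.2 = n - 1 ∧ 1 ≤ p.1 ∧ p.1 ≤ n - 2) ∨ (p.2 = p.1 + 1 ∧ 1 ≤ p.1 ∧ p.1 ≤ n - 3) := by
  obtain ⟨i, j⟩ := p
  simp only [Ix, Finset.mem_union, Finset.mem_image, Finset.mem_Icc, Prod.mk.injEq]
  constructor
  · rintro ((⟨a, h1, h2, h3⟩ | ⟨a, h1, h2, h3⟩) | ⟨a, h1, h2, h3⟩) <;> omega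
  · rintro (h | h | h)
    · exact Or.inl (Or.inl ⟨j, by omega, by omega, rfl⟩)
    · exact Or.inl (Or.inr ⟨i, by omega, rfl, by omega⟩)
    · exact Or.inr ⟨i, by omega, rfl, by omega⟩

lemma card_Ix {n : ℕ} (hn : 3 ≤ n) : (Ix n).card = 3 * n - 6 := by
  unfold Ix
  rw [Finset.card_union_of_disjoint, Finset.card_union_of_disjoint, Finset.card_image_of_injective,
    Finset.card_image_of_injective, Finset.card_image_of_injective]
  · simp; omega
  · intro a b h; simpa using h
  · intro a b h; simpa using h
  · intro a b h; simpa using h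
  · rw [Finset.disjoint_left]
    intro p h1 h2
    simp only [Finset.mem_image, Finset.mem_Icc] at h1 h2
    obtain ⟨a, h1, rfl⟩ := h1
    obtain ⟨b, h2, h3⟩ := h2
    simp only [Prod.mk.injEq] at h3
    omega
  · rw [Finset.disjoint_left]
    intro p h1 h2
    simp only [Finset.mem_union, Finset.mem_image, Finset.mem_Icc] at h1 h2
    obtain ⟨b, h2, rfl⟩ := h2
    simp only [Prod.mk.injEq] at h1
    rcases h1 with ⟨a, h1, h3⟩ | ⟨a, h1, h3⟩ <;> omega

lemma sg_cases (n : ℕ) (p : ℕ × ℕ) : sg n p = 1 ∨ sg n p = -1 := by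
  unfold sg; split_ifs <;> simp

lemma page {n : ℕ} (hn : 3 ≤ n) {p q : ℕ × ℕ} (hp : p ∈ Ix n) (hq : q ∈ Ix n) (h : sg n p = sg n q) :
    p.2 ≤ q.1 ∨ q.2 ≤ p.1 ∨ (p.1 ≤ q.1 ∧ q.2 ≤ p.2) ∨ (q.1 ≤ p.1 ∧ p.2 ≤ q.2) := by
  rw [mem_Ix] at hp hq
  unfold sg at h
  split_ifs at h with h1 h2 h2
  · omega
  · norm_num at h
  · norm_num at h
  · omega

theorem construct (n : ℕ) (hn : 3 ≤ n) (Img : Pt × Pt × Pt → Set Pt) (b : ℕ → ℕ → ℝ → Pt)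
    (hends : ∀ e, e.1 ∈ Img e ∧ e.2.2 ∈ Img e)
    (hin : ∀ i j : ℕ, i < j → j < n → ∀ σ : ℝ, (σ = 1 ∨ σ = -1) → ∀ z ∈ Img (pt i, b i j σ, pt j),
      z = pt i ∨ z = pt j ∨ ((i : ℝ) < z 0 ∧ z 0 < (j : ℝ) ∧ 0 < σ * z 1))
    (hnest : ∀ i j k l : ℕ, i < j → j < n → k < l → l < n → k ≤ i → j ≤ l → (k < i ∨ j < l) →
      ∀ σ : ℝ, (σ = 1 ∨ σ = -1) → ∀ z ∈ Img (pt i, b i j σ, pt j), z ∈ Img (pt k, b k l σ, pt l) →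
        ¬ 0 < σ * z 1) :
    ∃ (V : Finset Pt) (E : Finset (Pt × Pt × Pt)), V.card = n ∧ E.card = 3 * n - 6 ∧
      (∀ e ∈ E, ∃ i j : ℕ, ∃ σ : ℝ, i < j ∧ j < n ∧ (σ = 1 ∨ σ = -1) ∧ e = (pt i, b i j σ, pt j)) ∧
      (∀ e ∈ E, e.1 ∈ V ∧ e.2.2 ∈ V) ∧
      (∀ e ∈ E, ∀ f ∈ E, e ≠ f → Img e ≠ Img f) ∧
      (∀ e ∈ E, ∀ v ∈ V, (v : Pt) ∈ Img e → (v : Pt) ∈ edgeEndpoints e) ∧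
      (∀ e ∈ E, ∀ f ∈ E, e ≠ f → Img e ∩ Img f ⊆ edgeEndpoints e ∩ edgeEndpoints f) ∧
      (∀ e ∈ E, ∀ f ∈ E, e ≠ f → edgeEndpoints e ≠ edgeEndpoints f) := by
  classical
  let ed : ℕ × ℕ → Pt × Pt × Pt := fun p => (pt p.1, b p.1 p.2 (sg n p), pt p.2)
  have hlt : ∀ p ∈ Ix n, p.1 < p.2 ∧ p.2 < n := by
    intro p hp; rw [mem_Ix] at hp; omega
  have hedinj : Function.Injective ed := by
    rintro ⟨i, j⟩ ⟨k, l⟩ h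
    simp only [ed, Prod.mk.injEq] at h
    exact Prod.ext (pt_inj h.1) (pt_inj h.2.2)
  have hin' : ∀ p ∈ Ix n, ∀ z ∈ Img (ed p), z = pt p.1 ∨ z = pt p.2 ∨
      ((p.1 : ℝ) < z 0 ∧ z 0 < (p.2 : ℝ) ∧ 0 < sg n p * z 1) := fun p hp z hz =>
    hin p.1 p.2 (hlt p hp).1 (hlt p hp).2 _ (sg_cases n p) z hz
  have hz1 : ∀ p ∈ Ix n, ∀ z ∈ Img (ed p), z 1 = 0 → z ∈ edgeEndpoints (ed p) := by
    intro p hp z hz h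
    rcases hin' p hp z hz with h' | h' | h'
    · exact Or.inl h'
    · exact Or.inr h'
    · simp [h] at h'
  have hfin : ∀ p ∈ Ix n, ∀ z ∈ Img (ed p), z 1 ≠ 0 → ((p.1 : ℝ) < z 0 ∧ z 0 < (p.2 : ℝ) ∧ 0 < sg n p * z 1) := by
    intro p hp z hz h
    rcases hin' p hp z hz with rfl | rfl | h'
    · simp at h
    · simp at h
    · exact h'
  have hX : ∀ p ∈ Ix n, ∀ q ∈ Ix n, p ≠ q → ∀ z ∈ Img (ed p), z ∈ Img (ed q) → z 1 = 0 := by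
    intro p hp q hq hpq z hzp hzq
    by_contra h
    obtain ⟨p1, p2, p3⟩ := hfin p hp z hzp h
    obtain ⟨q1, q2, q3⟩ := hfin q hq z hzq h
    have hs : sg n p = sg n q := by
      rcases sg_cases n p with h1 | h1 <;> rcases sg_cases n q with h2 | h2 <;> rw [h1, h2] <;>
        rw [h1] at p3 <;> rw [h2] at q3 <;> linarith
    have hlp := hlt p hp
    have hlq := hlt q hq
    have hne : p.1 ≠ q.1 ∨ p.2 ≠ q.2 := by
      by_contra h'
      push Not at h'
      exact hpq (Prod.ext h'.1 h'.2)
    have hs' : (pt p.1, b p.1 p.2 (sg n q), pt p.2) = ed p := by rw [← hs]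
    rcases page hn hp hq hs with h' | h' | h' | h'
    · have : (p.2 : ℝ) ≤ q.1 := by exact_mod_cast h'
      linarith
    · have : (q.2 : ℝ) ≤ p.1 := by exact_mod_cast h'
      linarith
    · exact hnest q.1 q.2 p.1 p.2 hlq.1 hlq.2 hlp.1 hlp.2 h'.1 h'.2 (by omega) (sg n q) (sg_cases n q)
        z hzq (by rw [hs']; exact hzp) q3
    · exact hnest p.1 p.2 q.1 q.2 hlp.1 hlp.2 hlq.1 hlq.2 h'.1 h'.2 (by omega) (sg n q) (sg_cases n q)
        z (by rw [hs']; exact hzp) hzq q3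
  have hI : ∀ e ∈ (Ix n).image ed, ∀ f ∈ (Ix n).image ed, e ≠ f →
      Img e ∩ Img f ⊆ edgeEndpoints e ∩ edgeEndpoints f := by
    intro e he f hf hef z hz
    obtain ⟨p, hp, rfl⟩ := Finset.mem_image.1 he
    obtain ⟨q, hq, rfl⟩ := Finset.mem_image.1 hf
    have := hX p hp q hq (fun h => hef (by rw [h])) z hz.1 hz.2
    exact ⟨hz1 p hp z hz.1 this, hz1 q hq z hz.2 this⟩
  have hD : ∀ e ∈ (Ix n).image ed, ∀ f ∈ (Ix n).image ed, e ≠ f → edgeEndpoints e ≠ edgeEndpoints f := by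
    intro e he f hf hef h
    obtain ⟨p, hp, rfl⟩ := Finset.mem_image.1 he
    obtain ⟨q, hq, rfl⟩ := Finset.mem_image.1 hf
    have hlp := hlt p hp
    have hlq := hlt q hq
    simp only [edgeEndpoints, ed] at h
    have h1 : pt p.1 ∈ ({pt q.1, pt q.2} : Set Pt) := h ▸ (by simp)
    have h2 : pt p.2 ∈ ({pt q.1, pt q.2} : Set Pt) := h ▸ (by simp)
    simp only [Set.mem_insert_iff, Set.mem_singleton_iff, pt_inj.eq_iff] at h1 h2
    have hpq : p = q := Prod.ext (by omega) (by omega)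
    exact hef (by rw [hpq])
  refine ⟨(Finset.range n).image pt, (Ix n).image ed, ?_, ?_, ?_, ?_, ?_, ?_, hI, hD⟩
  · rw [Finset.card_image_of_injective _ pt_inj, Finset.card_range]
  · rw [Finset.card_image_of_injective _ hedinj, card_Ix hn]
  · intro e he
    obtain ⟨p, hp, rfl⟩ := Finset.mem_image.1 he
    exact ⟨p.1, p.2, sg n p, (hlt p hp).1, (hlt p hp).2, sg_cases n p, rfl⟩
  · intro e he
    obtain ⟨p, hp, rfl⟩ := Finset.mem_image.1 he
    have := hlt p hp
    exact ⟨Finset.mem_image_of_mem _ (Finset.mem_range.2 (by omega)),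
      Finset.mem_image_of_mem _ (Finset.mem_range.2 (by omega))⟩
  · intro e he f hf hef h
    apply hD e he f hf hef
    have key : ∀ e f, Img e ∩ Img f ⊆ edgeEndpoints e ∩ edgeEndpoints f → Img e = Img f →
        edgeEndpoints e ⊆ edgeEndpoints f := by
      intro e f h1 h2 x hx
      have : x ∈ Img e := by
        rcases hx with rfl | rfl
        · exact (hends e).1
        · exact (hends e).2
      exact (h1 ⟨this, h2 ▸ this⟩).2
    exact Subset.antisymm (key e f (hI e he f hf hef) h) (key f e (hI f hf e he hef.symm) h.symm)
  · intro e he v hv hve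
    obtain ⟨p, hp, rfl⟩ := Finset.mem_image.1 he
    obtain ⟨m, -, rfl⟩ := Finset.mem_image.1 hv
    exact hz1 p hp _ hve (pt_one m)

lemma angle_of {a z c : Pt} {α M : ℝ} (h0 : 0 ≤ α) (h1 : α ≤ π) (hM : 0 < M)
    (hd : dt a z c = M * Real.cos α) (hc : cr a z c ^ 2 = (M * Real.sin α) ^ 2) : ∠ a z c = α := by
  rw [angle_eq, hc, hd, show (M * Real.cos α) ^ 2 + (M * Real.sin α) ^ 2 = M ^ 2 by
    linear_combination M ^ 2 * Real.sin_sq_add_cos_sq α, Real.sqrt_sq hM.le, mul_div_cancel_left₀ _ hM.ne',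
    Real.arccos_cos h0 h1]

lemma of_angle {a z c : Pt} {α : ℝ} (h : ∠ a z c = α) (hc : cr a z c ≠ 0) :
    dt a z c * Real.sin α = Real.cos α * |cr a z c| := by
  set M := √(dt a z c ^ 2 + cr a z c ^ 2) with hM
  have hp : 0 < dt a z c ^ 2 + cr a z c ^ 2 := by positivity
  have hM0 : 0 < M := Real.sqrt_pos.2 hp
  have hM2 : M ^ 2 = dt a z c ^ 2 + cr a z c ^ 2 := Real.sq_sqrt hp.le
  have e1 : Real.cos α = dt a z c / M := by
    rw [← h, angle_eq, Real.cos_arccos]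
    · rw [le_div_iff₀ hM0]
      nlinarith [abs_le_of_sq_le_sq' (show (dt a z c) ^ 2 ≤ M ^ 2 by rw [hM2]; nlinarith [sq_nonneg (cr a z c)]) hM0.le]
    · rw [div_le_one hM0]
      exact (abs_le_of_sq_le_sq' (show (dt a z c) ^ 2 ≤ M ^ 2 by rw [hM2]; nlinarith [sq_nonneg (cr a z c)]) hM0.le).2
  have e2 : Real.sin α = |cr a z c| / M := by
    have hs : 0 ≤ Real.sin α := by
      rw [← h]; exact Real.sin_nonneg_of_nonneg_of_le_pi (EuclideanGeometry.angle_nonneg _ _ _)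
        (EuclideanGeometry.angle_le_pi _ _ _)
    rw [← abs_of_nonneg hs, ← abs_of_pos hM0, ← abs_div, ← sq_eq_sq_iff_abs_eq_abs, div_pow, hM2,
      Real.sin_sq, e1, div_pow, hM2]
    field_simp; ring
  rw [e1, e2]; ring

set_option maxHeartbeats 1000000 in
theorem arc_lower (n : ℕ) (hn : 3 ≤ n) (α : ℝ) (h1 : π / 2 ≤ α) (h2 : α < π) :
    ∃ (V : Finset Pt) (E : Finset (Pt × Pt × Pt)), V.card = n ∧
        IsPlaneArcGraph α V E ∧ E.card = 3 * n - 6 := by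
  have hs : 0 < Real.sin α := Real.sin_pos_of_pos_of_lt_pi (by linarith [Real.pi_pos]) h2
  have hc : Real.cos α ≤ 0 := Real.cos_nonpos_of_pi_div_two_le_of_le h1 (by linarith [Real.pi_pos])
  have hs2 : 0 < Real.sin (α / 2) := Real.sin_pos_of_pos_of_lt_pi (by linarith [Real.pi_pos]) (by linarith [Real.pi_pos])
  have hc2 : 0 < Real.cos (α / 2) := Real.cos_pos_of_mem_Ioo ⟨by linarith [Real.pi_pos], by linarith⟩
  have hsd : Real.sin α = 2 * Real.sin (α / 2) * Real.cos (α / 2) := by rw [← Real.sin_two_mul]; congr 1; ring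
  have hcd : Real.cos α = Real.cos (α / 2) ^ 2 - Real.sin (α / 2) ^ 2 := by
    rw [← Real.cos_two_mul']; congr 1; ring
  set S := Real.sin (α / 2)
  set C := Real.cos (α / 2)
  let b : ℕ → ℕ → ℝ → Pt := fun i j σ => !₂[((i : ℝ) + j) / 2, σ * (((j : ℝ) - i) / 2 * (C / S))]
  have hne : ∀ i j : ℕ, i < j → pt i ≠ pt j := fun i j h h' => h.ne (pt_inj h')
  have hcr : ∀ i j : ℕ, ∀ z, cr (pt i) z (pt j) = z 1 * ((j : ℝ) - i) := by
    intro i j z; simp [cr]; ring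
  have hdt : ∀ i j : ℕ, ∀ z, dt (pt i) z (pt j) = z 1 ^ 2 - (z 0 - i) * (j - z 0) := by
    intro i j z; simp [dt]; ring
  have hang : ∀ i j : ℕ, i < j → ∀ σ : ℝ, (σ = 1 ∨ σ = -1) → ∠ (pt i) (b i j σ) (pt j) = α := by
    intro i j hij σ hσ
    have hij' : (i : ℝ) < j := by exact_mod_cast hij
    have hσ2 : σ ^ 2 = 1 := by rcases hσ with rfl | rfl <;> norm_num
    refine angle_of (M := ((j : ℝ) - i) ^ 2 / (4 * S ^ 2)) (by linarith [Real.pi_pos]) h2.le ?_ ?_ ?_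
    · have : 0 < (j : ℝ) - i := by linarith
      positivity
    · rw [hdt, hcd]; simp [b]; field_simp; rw [hσ2]; ring
    · rw [hcr, hsd]; simp [b]; field_simp; rw [hσ2]; ring
  -- points of the arcs
  have hz : ∀ i j : ℕ, i < j → ∀ σ : ℝ, (σ = 1 ∨ σ = -1) → ∀ z ∈ arcImage (pt i, b i j σ, pt j),
      z = pt i ∨ z = pt j ∨ (0 < σ * z 1 ∧
        ((σ * z 1) ^ 2 - (z 0 - i) * (j - z 0)) * Real.sin α = Real.cos α * (σ * z 1 * (j - i))) := by
    intro i j hij σ hσ z hz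
    have hij' : (i : ℝ) < j := by exact_mod_cast hij
    have hij0 : 0 < (j : ℝ) - i := by linarith
    have hσ2 : σ ^ 2 = 1 := by rcases hσ with rfl | rfl <;> norm_num
    rcases hz with (h | h) | ⟨h1, h2⟩
    · exact Or.inl h
    · exact Or.inr (Or.inl h)
    · right; right
      simp only at h1 h2
      rw [sss (hne i j hij), hcr, hcr] at h1
      have hb1 : b i j σ 1 = σ * (((j : ℝ) - i) / 2 * (C / S)) := by simp [b]
      rw [hb1] at h1
      have hpos : 0 < σ * z 1 := by
        have hk : 0 < ((j : ℝ) - i) ^ 3 / 2 * (C / S) := by positivity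
        have : z 1 * ((j : ℝ) - i) * (σ * (((j : ℝ) - i) / 2 * (C / S)) * (j - i)) =
          (σ * z 1) * (((j : ℝ) - i) ^ 3 / 2 * (C / S)) := by ring
        rw [this] at h1
        exact (pos_iff_pos_of_mul_pos h1).2 hk
      refine ⟨hpos, ?_⟩
      have hz1 : z 1 ≠ 0 := by intro h; simp [h] at hpos
      have := of_angle (h2.trans (hang i j hij σ hσ)) (by rw [hcr]; exact mul_ne_zero hz1 hij0.ne')
      have habs : |z 1 * ((j : ℝ) - i)| = σ * z 1 * (j - i) := by
        rw [abs_mul, abs_of_pos hij0]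
        congr 1
        rcases hσ with rfl | rfl
        · rw [one_mul] at *; exact abs_of_pos hpos
        · rw [neg_one_mul] at *; exact abs_of_neg (by linarith)
      rw [hdt, hcr, habs] at this
      rw [mul_pow, hσ2, one_mul]
      exact this
  have hpq : ∀ i j : ℕ, i < j → ∀ Y x : ℝ, 0 < Y → (Y ^ 2 - (x - i) * (j - x)) * Real.sin α = Real.cos α * (Y * (j - i)) →
      (i : ℝ) < x ∧ x < j := by
    intro i j hij Y x hY h
    have hij' : (i : ℝ) < j := by exact_mod_cast hij
    have h3 : 0 < (x - i) * (j - x) := by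
      have h4 : 0 ≤ -(Real.cos α) * (Y * (j - i)) := by
        apply mul_nonneg (by linarith)
        exact mul_nonneg hY.le (by linarith)
      have h5 : 0 < Y ^ 2 * Real.sin α := by positivity
      have h6 : 0 < ((x - i) * (j - x)) * Real.sin α := by nlinarith
      exact (pos_iff_pos_of_mul_pos h6).2 hs
    constructor <;> nlinarith
  have hpos : ∀ p q Y : ℝ, 0 < Y → 0 < p → 0 < q → (Y ^ 2 - p * q) * Real.sin α = Real.cos α * (Y * (p + q)) →
      (Real.sin α * p + Real.cos α * Y) * (Real.sin α * q + Real.cos α * Y) = Y ^ 2 ∧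
      0 < Real.sin α * p + Real.cos α * Y ∧ 0 < Real.sin α * q + Real.cos α * Y := by
    intro p q Y hY hp hq h
    have e : (Real.sin α * p + Real.cos α * Y) * (Real.sin α * q + Real.cos α * Y) = Y ^ 2 := by
      linear_combination Y ^ 2 * Real.sin_sq_add_cos_sq α - Real.sin α * h
    have hY2 : 0 < Y ^ 2 := by positivity
    have hp' : 0 < Real.sin α * p := by positivity
    have hq' : 0 < Real.sin α * q := by positivity
    refine ⟨e, ?_⟩
    rcases (mul_pos_iff.1 (e.symm ▸ hY2)) with h | ⟨h3, h4⟩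
    · exact h
    · exfalso
      have hc1 : Real.cos α ^ 2 ≤ 1 := Real.cos_sq_le_one α
      nlinarith [mul_pos hp' (neg_pos.2 h4), mul_nonneg hq'.le (mul_nonneg (neg_nonneg.2 hc) hY.le)]
  obtain ⟨V, E, hV, hE, k1, k2, k3, k4, k5, k6⟩ := construct n hn arcImage b
    (fun e => ⟨Or.inl (by simp), Or.inl (by simp)⟩)
    (fun i j hij _ σ hσ z hzz => by
      rcases hz i j hij σ hσ z hzz with h | h | ⟨h1, h2⟩
      · exact Or.inl h
      · exact Or.inr (Or.inl h)
      · obtain ⟨h3, h4⟩ := hpq i j hij _ _ h1 h2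
        exact Or.inr (Or.inr ⟨h3, h4, h1⟩))
    (fun i j k l hij _ hkl _ hki hjl hor σ hσ z hz1 hz2 hY => by
      have hend : ∀ m, z ≠ pt m := by rintro m rfl; simp at hY
      have g1 := ((hz i j hij σ hσ z hz1).resolve_left (hend _)).resolve_left (hend _)
      have g2 := ((hz k l hkl σ hσ z hz2).resolve_left (hend _)).resolve_left (hend _)
      obtain ⟨a1, a2⟩ := hpq i j hij _ _ hY g1.2
      obtain ⟨b1, b2⟩ := hpq k l hkl _ _ hY g2.2
      obtain ⟨c1, c2, c3⟩ := hpos (z 0 - i) (j - z 0) (σ * z 1) hY (by linarith) (by linarith) (by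
        rw [g1.2]; ring)
      obtain ⟨d1, d2, d3⟩ := hpos (z 0 - k) (l - z 0) (σ * z 1) hY (by linarith) (by linarith) (by
        rw [g2.2]; ring)
      have hki' : (k : ℝ) ≤ i := by exact_mod_cast hki
      have hjl' : (j : ℝ) ≤ l := by exact_mod_cast hjl
      have m1 : Real.sin α * (z 0 - i) + Real.cos α * (σ * z 1) ≤ Real.sin α * (z 0 - k) + Real.cos α * (σ * z 1) := by
        gcongr
      have m2 : Real.sin α * (j - z 0) + Real.cos α * (σ * z 1) ≤ Real.sin α * (l - z 0) + Real.cos α * (σ * z 1) := by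
        gcongr
      rcases hor with h | h
      · have h' : (k : ℝ) < i := by exact_mod_cast h
        have m1' : Real.sin α * (z 0 - i) + Real.cos α * (σ * z 1) < Real.sin α * (z 0 - k) + Real.cos α * (σ * z 1) := by
          gcongr
        have := mul_lt_mul m1' m2 c3 d2.le
        linarith
      · have h' : (j : ℝ) < l := by exact_mod_cast h
        have m2' : Real.sin α * (j - z 0) + Real.cos α * (σ * z 1) < Real.sin α * (l - z 0) + Real.cos α * (σ * z 1) := by
          gcongr
        have := mul_lt_mul' m1 m2' c3.le d2
        linarith)
  refine ⟨V, E, hV, ⟨⟨fun e he => ⟨?_, k2 e he⟩, k3, k4, k5⟩, k6⟩, hE⟩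
  obtain ⟨i, j, σ, hij, _, hσ, rfl⟩ := k1 e he
  refine ⟨hne i j hij, ?_, hang i j hij σ hσ⟩
  rw [mem_line (hne i j hij), hcr]
  have hij' : (i : ℝ) < j := by exact_mod_cast hij
  have hij0 : 0 < (j : ℝ) - i := by linarith
  have hσ0 : σ ≠ 0 := by rcases hσ with rfl | rfl <;> norm_num
  have : b i j σ 1 = σ * (((j : ℝ) - i) / 2 * (C / S)) := by simp [b]
  simp only
  rw [this]
  positivity

end Pln
end

section
namespace Pln
open Complex Filter Topology

/-- slopes of the tents -/
lemma tent_params (n : ℕ) (hn : 3 ≤ n) (α : ℝ) (h1 : 0 < α) (h2 : α < π) :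
    ∃ μ ν : ℕ → ℝ, (∀ s < 2 * n, 0 < μ s ∧ 0 < ν s ∧ ∃ M : ℝ, 0 < M ∧
        1 - μ s * ν s = M * Real.cos α ∧ μ s + ν s = M * Real.sin α) ∧
      (∀ s < 2 * n, ∀ t < 2 * n, s < t → μ t < μ s ∧ ν s < ν t) ∧
      (∀ s < 2 * n, ∀ t < 2 * n, ∀ r < 2 * n, n * (μ s - μ t) < μ r + ν r ∧ n * (ν s - ν t) < μ r + ν r) := by
  have hs : 0 < Real.sin α := Real.sin_pos_of_pos_of_lt_pi h1 h2
  have hsc := Real.sin_sq_add_cos_sq α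
  have hc1 : Real.cos α < 1 := by nlinarith [Real.cos_le_one α]
  have hc2 : -1 ≤ Real.cos α := Real.neg_one_le_cos α
  generalize Real.sin α = S at *
  generalize Real.cos α = C at *
  have hn' : (3 : ℝ) ≤ n := by exact_mod_cast hn
  obtain ⟨ε, hε⟩ : ∃ ε, ε = (1 - C) / (8 * n) := ⟨_, rfl⟩
  have hε0 : 0 < ε := by rw [hε]; apply div_pos <;> linarith
  have hεn : 8 * (n * ε) = 1 - C := by rw [hε]; field_simp
  have hεc : ε ≤ (1 - C) / 24 := by nlinarith
  let L : ℕ → ℝ := fun s => 1 - ε * (s / (2 * n))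
  have hLm : ∀ s t : ℕ, s < t → L t < L s := by
    intro s t hst
    have : (s : ℝ) < t := by exact_mod_cast hst
    simp only [L]
    gcongr
  have hL1 : ∀ s < 2 * n, 1 - ε ≤ L s ∧ L s ≤ 1 := by
    intro s hs
    have h3 : (s : ℝ) < 2 * n := by exact_mod_cast hs
    have h4 : (s : ℝ) / (2 * n) ≤ 1 := by rw [div_le_one (by linarith)]; exact h3.le
    have h5 : 0 ≤ (s : ℝ) / (2 * n) := by positivity
    simp only [L]
    constructor <;> nlinarith
  clear_value L
  have hLh : ∀ s < 2 * n, 1 / 2 ≤ L s := fun s hs => by linarith [(hL1 s hs).1]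
  have hLp : ∀ s < 2 * n, 0 < L s := fun s hs => by linarith [hLh s hs]
  have hLi : ∀ s < 2 * n, 1 ≤ 1 / L s := fun s hs => by
    rw [le_div_iff₀ (hLp s hs), one_mul]; exact (hL1 s hs).2
  have hsum : ∀ s < 2 * n, 0 < L s + 1 / L s - 2 * C := fun s hs => by
    linarith [hLi s hs, (hL1 s hs).1]
  refine ⟨fun s => (L s - C) / S, fun s => (1 / L s - C) / S, ?_, ?_, ?_⟩
  · intro s hs'
    have := hLp s hs'
    refine ⟨div_pos (by linarith [(hL1 s hs').1]) hs, div_pos (by linarith [hLi s hs']) hs,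
      (L s + 1 / L s - 2 * C) / S ^ 2, div_pos (hsum s hs') (by positivity), ?_, ?_⟩
    · field_simp; linear_combination (L s) * hsc
    · field_simp; ring
  · intro s hs' t ht hst
    have h3 := hLm s t hst
    constructor
    · simp only; gcongr
    · have := hLp t ht
      simp only; gcongr
  · intro s hs' t ht r hr
    have e : (L r - C) / S + (1 / L r - C) / S = (L r + 1 / L r - 2 * C) / S := by ring
    have hb : 1 - C < L r + 1 / L r - 2 * C := by
      linarith [hLi r hr, (hL1 r hr).1]
    have a1 := hL1 s hs'
    have a2 := hL1 t ht
    simp only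
    rw [e]
    constructor
    · rw [show (n : ℝ) * ((L s - C) / S - (L t - C) / S) = (n * (L s - L t)) / S by ring]
      gcongr
      have : n * (L s - L t) ≤ n * ε := by
        apply mul_le_mul_of_nonneg_left _ (by linarith)
        linarith
      nlinarith
    · rw [show (n : ℝ) * ((1 / L s - C) / S - (1 / L t - C) / S) = (n * (1 / L s - 1 / L t)) / S by ring]
      gcongr
      have h3 : 1 / L s - 1 / L t ≤ 4 * ε := by
        have h4 : 1 / L s ≤ 1 + 4 * ε := by
          rw [div_le_iff₀ (hLp s hs')]; nlinarith [hLh s hs']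
        linarith [hLi t ht]
      have : n * (1 / L s - 1 / L t) ≤ n * (4 * ε) := mul_le_mul_of_nonneg_left h3 (by linarith)
      nlinarith

set_option maxHeartbeats 1000000 in
theorem bend_lower (n : ℕ) (hn : 3 ≤ n) (α : ℝ) (h1 : 0 < α) (h2 : α < π) :
    ∃ (V : Finset Pt) (E : Finset (Pt × Pt × Pt)), V.card = n ∧
        IsPlaneBendGraph α V E ∧ E.card = 3 * n - 6 := by
  obtain ⟨μ, ν, t1, t2, t3⟩ := tent_params n hn α h1 h2
  let h : ℕ → ℕ → ℝ := fun i j => ((j : ℝ) - i) / (μ (i + j) + ν (i + j))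
  let b : ℕ → ℕ → ℝ → Pt := fun i j σ => !₂[(i : ℝ) + μ (i + j) * h i j, σ * h i j]
  have hne : ∀ i j : ℕ, i < j → pt i ≠ pt j := fun i j h h' => h.ne (pt_inj h')
  have hh : ∀ i j : ℕ, i < j → j < n → 0 < h i j ∧ (j : ℝ) - i = (μ (i + j) + ν (i + j)) * h i j := by
    intro i j hij hj
    have hij' : (i : ℝ) < j := by exact_mod_cast hij
    obtain ⟨p1, p2, -⟩ := t1 (i + j) (by omega)
    have p3 := add_pos p1 p2
    refine ⟨div_pos (by linarith) p3, ?_⟩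
    simp only [h]; field_simp
  have hang : ∀ i j : ℕ, i < j → j < n → ∀ σ : ℝ, (σ = 1 ∨ σ = -1) → ∠ (pt i) (b i j σ) (pt j) = α := by
    intro i j hij hj σ hσ
    have hσ2 : σ ^ 2 = 1 := by rcases hσ with rfl | rfl <;> norm_num
    obtain ⟨p1, p2, M, hM, e1, e2⟩ := t1 (i + j) (by omega)
    obtain ⟨q1, q2⟩ := hh i j hij hj
    have b0 : b i j σ 0 = (i : ℝ) + μ (i + j) * h i j := by simp [b]
    have b1 : b i j σ 1 = σ * h i j := by simp [b]
    have hjb : (j : ℝ) - b i j σ 0 = ν (i + j) * h i j := by rw [b0]; linear_combination q2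
    refine angle_of (M := M * h i j ^ 2) h1.le h2.le (by positivity) ?_ ?_
    · simp only [dt, pt_zero, pt_one, hjb]
      rw [b0, b1]
      linear_combination (h i j) ^ 2 * hσ2 + (h i j) ^ 2 * e1
    · simp only [cr, pt_zero, pt_one, hjb]
      rw [b0, b1]
      rw [show (((i : ℝ) - (i + μ (i + j) * h i j)) * (0 - σ * h i j) - (0 - σ * h i j) * (ν (i + j) * h i j)) =
        σ * ((μ (i + j) + ν (i + j)) * (h i j) ^ 2) by ring, e2, mul_pow, hσ2]
      ring
  -- points of the tents
  have hz : ∀ i j : ℕ, i < j → j < n → ∀ σ : ℝ, (σ = 1 ∨ σ = -1) → ∀ z ∈ bendImage (pt i, b i j σ, pt j),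
      0 ≤ σ * z 1 ∧ σ * z 1 ≤ h i j ∧ μ (i + j) * (σ * z 1) ≤ z 0 - i ∧ ν (i + j) * (σ * z 1) ≤ j - z 0 ∧
      (μ (i + j) * (σ * z 1) = z 0 - i ∨ ν (i + j) * (σ * z 1) = j - z 0) := by
    intro i j hij hj σ hσ z hz
    have hσ2 : σ ^ 2 = 1 := by rcases hσ with rfl | rfl <;> norm_num
    obtain ⟨p1, p2, -⟩ := t1 (i + j) (by omega)
    obtain ⟨q1, q2⟩ := hh i j hij hj
    rcases hz with hz | hz
    · simp only at hz
      rw [segment_eq_image_lineMap] at hz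
      obtain ⟨t, ⟨ht0, ht1⟩, rfl⟩ := hz
      have z0 : (AffineMap.lineMap (pt i) (b i j σ) t : Pt) 0 = i + t * (μ (i + j) * h i j) := by
        simp [AffineMap.lineMap_apply, b]; ring
      have z1 : σ * (AffineMap.lineMap (pt i) (b i j σ) t : Pt) 1 = t * h i j := by
        simp [AffineMap.lineMap_apply, b]; linear_combination t * h i j * hσ2
      rw [z0, z1]
      have hp := mul_nonneg (sub_nonneg.2 ht1) (mul_pos (add_pos p1 p2) q1).le
      refine ⟨by positivity, by nlinarith, by nlinarith, by nlinarith, Or.inl (by ring)⟩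
    · simp only at hz
      rw [segment_symm, segment_eq_image_lineMap] at hz
      obtain ⟨t, ⟨ht0, ht1⟩, rfl⟩ := hz
      have z0 : (AffineMap.lineMap (pt j) (b i j σ) t : Pt) 0 = j - t * (ν (i + j) * h i j) := by
        simp [AffineMap.lineMap_apply, b]; linear_combination (-t) * q2
      have z1 : σ * (AffineMap.lineMap (pt j) (b i j σ) t : Pt) 1 = t * h i j := by
        simp [AffineMap.lineMap_apply, b]; linear_combination t * h i j * hσ2
      rw [z0, z1]
      have hp := mul_nonneg (sub_nonneg.2 ht1) (mul_pos (add_pos p1 p2) q1).le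
      refine ⟨by positivity, by nlinarith, by nlinarith, by nlinarith, Or.inr (by ring)⟩
  obtain ⟨V, E, hV, hE, k1, k2, k3, k4, k5, k6⟩ := construct n hn bendImage b
    (fun e => ⟨Or.inl (left_mem_segment ℝ _ _), Or.inr (right_mem_segment ℝ _ _)⟩)
    (fun i j hij hj σ hσ z hzz => by
      obtain ⟨a1, a2, a3, a4, a5⟩ := hz i j hij hj σ hσ z hzz
      obtain ⟨p1, p2, -⟩ := t1 (i + j) (by omega)
      have hσ0 : σ ≠ 0 := by rcases hσ with rfl | rfl <;> norm_num
      rcases a1.lt_or_eq with a1 | a1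
      · exact Or.inr (Or.inr ⟨by nlinarith, by nlinarith, a1⟩)
      · have hz1 : z 1 = 0 := (mul_eq_zero.1 a1.symm).resolve_left hσ0
        rw [← a1] at a5
        rcases a5 with h | h
        · left
          ext m; fin_cases m
          · simp; linarith
          · simp [hz1]
        · right; left
          ext m; fin_cases m
          · simp; linarith
          · simp [hz1])
    (fun i j k l hij hj hkl hl hki hjl hor σ hσ z hz1 hz2 hY => by
      obtain ⟨a1, a2, a3, a4, -⟩ := hz i j hij hj σ hσ z hz1
      obtain ⟨-, -, -, -, a5⟩ := hz k l hkl hl σ hσ z hz2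
      generalize σ * z 1 = Y at *
      obtain ⟨p1, p2, -⟩ := t1 (i + j) (by omega)
      obtain ⟨q1, q2⟩ := hh i j hij hj
      have hki' : (k : ℝ) ≤ i := by exact_mod_cast hki
      have hjl' : (j : ℝ) ≤ l := by exact_mod_cast hjl
      have hjn : (j : ℝ) - i ≤ n := by
        have : (j : ℝ) < n := by exact_mod_cast hj
        have : (0 : ℝ) ≤ i := by positivity
        linarith
      have hYn : (μ (i + j) + ν (i + j)) * Y ≤ n := by
        calc _ ≤ (μ (i + j) + ν (i + j)) * h i j := by gcongr
          _ ≤ n := by rw [← q2]; exact hjn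
      have small : ∀ x, n * x < μ (i + j) + ν (i + j) → x * Y < 1 := by
        intro x hx
        have hn0 : (0 : ℝ) < n := by exact_mod_cast (by omega : 0 < n)
        have : n * (x * Y) < n * 1 := by nlinarith
        exact lt_of_mul_lt_mul_left this hn0.le
      have e1 : (μ (k + l) - μ (i + j)) * Y < 1 := small _ (t3 _ (by omega) _ (by omega) _ (by omega)).1
      have e2 : (ν (k + l) - ν (i + j)) * Y < 1 := small _ (t3 _ (by omega) _ (by omega) _ (by omega)).2
      rcases a5 with a5 | a5
      · by_cases hlt : i + j < k + l
        · have := (t2 _ (by omega) _ (by omega) hlt).1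
          nlinarith
        · have : (k : ℝ) + 1 ≤ i := by exact_mod_cast (by omega : k + 1 ≤ i)
          nlinarith
      · by_cases hlt : k + l < i + j
        · have := (t2 _ (by omega) _ (by omega) hlt).2
          nlinarith
        · have : (j : ℝ) + 1 ≤ l := by exact_mod_cast (by omega : j + 1 ≤ l)
          nlinarith)
  refine ⟨V, E, hV, ⟨⟨fun e he => ⟨?_, k2 e he⟩, k3, k4, k5⟩, k6⟩, hE⟩
  obtain ⟨i, j, σ, hij, hj, hσ, rfl⟩ := k1 e he
  exact ⟨hne i j hij, hang i j hij hj σ hσ⟩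

end Pln
end

/-- For every `n ≥ 3`: for all `α ∈ (0,π)`, plane `α`-bend graphs on `n` points have at
most `3n-6` edges and this is attained; for all `α ∈ [π/2,π)`, the same holds for plane
`α`-arc graphs. -/
theorem stmt_6 (n : ℕ) (hn : 3 ≤ n) :
    (∀ α ∈ Set.Ioo (0:ℝ) π,
      (∀ (V : Finset Pt) (E : Finset (Pt × Pt × Pt)), V.card = n →
        IsPlaneBendGraph α V E → E.card ≤ 3 * n - 6) ∧
      (∃ (V : Finset Pt) (E : Finset (Pt × Pt × Pt)), V.card = n ∧
        IsPlaneBendGraph α V E ∧ E.card = 3 * n - 6)) ∧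
    (∀ α ∈ Set.Ico (π/2) π,
      (∀ (V : Finset Pt) (E : Finset (Pt × Pt × Pt)), V.card = n →
        IsPlaneArcGraph α V E → E.card ≤ 3 * n - 6) ∧
      (∃ (V : Finset Pt) (E : Finset (Pt × Pt × Pt)), V.card = n ∧
        IsPlaneArcGraph α V E ∧ E.card = 3 * n - 6)) := by
  refine ⟨fun α hα => ⟨fun V E hV hP => Pln.bend_upper α hα.1 n hn V E hV hP,
    Pln.bend_lower n hn α hα.1 hα.2⟩, fun α hα => ⟨fun V E hV hP => Pln.arc_upper α n hn V E hV hP,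
    Pln.arc_lower n hn α hα.1 hα.2⟩⟩
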